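/- Let M be an o-minimal structure and let S be a definable downward directed family of subsets of M^n. Then there exists a complete definable downward directed family of subsets of M^n that is finer than S; in particular, S extends to a definable n-type that has a definable basis. -/

import Mathlib

open FirstOrder Set

/-- `M` is an o-minimal `L`-structure: a densely linearly ordered structure without endpoints,
whose order is `∅`-definable, and in which every definable (with parameters) subset of `M`
is a finite union of points and open intervals with endpoints in `M ∪ {±∞}`. -/
def IsOMinimal (L : FirstOrder.Language) (M : Type*) [L.Structure M] [LinearOrder M] : Prop :=
  Nonempty M ∧ DenselyOrdered M ∧ NoMinOrder M ∧ NoMaxOrder M ∧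
  Set.Definable (∅ : Set M) L {v : Fin 2 → M | v 0 < v 1} ∧
  ∀ s : Set M, Set.Definable₁ (Set.univ : Set M) L s →
    ∃ F : Finset (Set M), s = ⋃₀ (F : Set (Set M)) ∧
      ∀ t ∈ F, (∃ a : M, t = {a}) ∨ (∃ a b : M, t = Set.Ioo a b) ∨
        (∃ a : M, t = Set.Ioi a) ∨ (∃ a : M, t = Set.Iio a) ∨ t = Set.univ

/-- The fiber over `u` of a set `D ⊆ M^{m+n}`, i.e. the set `φ(u, M^n)`. -/
def famFiber {M : Type*} {m n : ℕ} (D : Set (Fin m ⊕ Fin n → M)) (u : Fin m → M) :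
    Set (Fin n → M) :=
  {v | Sum.elim u v ∈ D}

/-- An `A`-definable family of subsets of `M^n`: the family of fibers `φ(u, M^n)` for `u`
ranging over an `A`-definable index set `Ω`, where `φ` is `A`-definable. -/
def IsDefFamily (L : FirstOrder.Language) {M : Type*} [L.Structure M] (A : Set M) (n : ℕ)
    (S : Set (Set (Fin n → M))) : Prop :=
  ∃ (m : ℕ) (Ω : Set (Fin m → M)) (D : Set (Fin m ⊕ Fin n → M)),
    Set.Definable A L Ω ∧ Set.Definable A L D ∧ S = famFiber D '' Ω

/-- A family of sets is downward directed: it does not contain `∅` and any two members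
contain a common member. -/
def DirectedFam {α : Type*} (S : Set (Set α)) : Prop :=
  ∅ ∉ S ∧ ∀ X ∈ S, ∀ Y ∈ S, ∃ Z ∈ S, Z ⊆ X ∩ Y

/-- `S` is finer than `F`: every member of `F` contains a member of `S`. -/
def FinerThan {α : Type*} (S F : Set (Set α)) : Prop :=
  ∀ X ∈ F, ∃ Y ∈ S, Y ⊆ X

/-- A (complete) `n`-type over `M`: an ultrafilter on the Boolean algebra of definable
subsets of `M^n`. -/
def IsTypeOn (L : FirstOrder.Language) {M : Type*} [L.Structure M] (n : ℕ)
    (p : Set (Set (Fin n → M))) : Prop :=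
  (∀ X ∈ p, Set.Definable (Set.univ : Set M) L X) ∧
  ∅ ∉ p ∧
  (∀ X ∈ p, ∀ Y ∈ p, X ∩ Y ∈ p) ∧
  (∀ X ∈ p, ∀ Y : Set (Fin n → M), Set.Definable (Set.univ : Set M) L Y → X ⊆ Y → Y ∈ p) ∧
  (∀ X : Set (Fin n → M), Set.Definable (Set.univ : Set M) L X → X ∈ p ∨ Xᶜ ∈ p)

/-- A type `p` is `A`-definable if for every `∅`-definable `D ⊆ M^{m+n}` the set of
parameters `u` with `φ(u, M^n) ∈ p` is `A`-definable. -/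
def IsDefTypeOver (L : FirstOrder.Language) {M : Type*} [L.Structure M] (A : Set M) (n : ℕ)
    (p : Set (Set (Fin n → M))) : Prop :=
  ∀ (m : ℕ) (D : Set (Fin m ⊕ Fin n → M)), Set.Definable (∅ : Set M) L D →
    Set.Definable A L {u : Fin m → M | famFiber D u ∈ p}

/-- A family `F` is complete for a family `X` if each member of `X` either contains a member
of `F` or is disjoint from one. -/
def CompleteFor {α : Type*} (F X : Set (Set α)) : Prop :=
  ∀ Y ∈ X, ∃ Z ∈ F, Z ⊆ Y ∨ Z ∩ Y = ∅

/-- A family of subsets of `M^n` is complete if it decides every definable set. -/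
def IsCompleteFam (L : FirstOrder.Language) {M : Type*} [L.Structure M] (n : ℕ)
    (S : Set (Set (Fin n → M))) : Prop :=
  ∀ X : Set (Fin n → M), Set.Definable (Set.univ : Set M) L X → ∃ Z ∈ S, Z ⊆ X ∨ Z ∩ X = ∅

/-- `B` is a basis for the type `p`: a downward directed subfamily generating `p`. -/
def IsBasisOfType {α : Type*} (B p : Set (Set α)) : Prop :=
  B ⊆ p ∧ DirectedFam B ∧ ∀ Y ∈ p, ∃ Z ∈ B, Z ⊆ Y

/-- `p` has an `A`-definable basis. -/
def HasDefBasis (L : FirstOrder.Language) {M : Type*} [L.Structure M] (A : Set M) (n : ℕ)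
    (p : Set (Set (Fin n → M))) : Prop :=
  ∃ B, IsDefFamily L A n B ∧ IsBasisOfType B p

/-- `S` has a finite tame transversal: it is covered by finitely many subfamilies, each of
which extends to a definable type. -/
def HasFTT (L : FirstOrder.Language) {M : Type*} [L.Structure M] (n : ℕ)
    (S : Set (Set (Fin n → M))) : Prop :=
  ∃ (N : ℕ) (p : Fin N → Set (Set (Fin n → M))),
    (∀ i, IsTypeOn L n (p i) ∧ IsDefTypeOver L (Set.univ : Set M) n (p i)) ∧
    ∀ X ∈ S, ∃ i, X ∈ p i

/-- The `(m,n)`-property: among any `m` members of the family, some `n` have nonempty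
intersection. -/
def HasMNProperty {α : Type*} (S : Set (Set α)) (m n : ℕ) : Prop :=
  ∀ F : Finset (Set α), ↑F ⊆ S → F.card = m →
    ∃ G ⊆ F, G.card = n ∧ (⋂₀ (G : Set (Set α))).Nonempty



open FirstOrder Set

namespace OM
universe u v w

class Crd (M : Type u) (α : Type u) where
  ι : Type
  fin : Finite ι
  e : α ≃ (ι → M)

attribute [instance] Crd.fin

instance (priority := 2000) crdSelf (M : Type u) : Crd M M where
  ι := Unit
  fin := inferInstance
  e := (Equiv.funUnique Unit M).symm

instance crdFin (M : Type u) (n : ℕ) : Crd M (Fin n → M) where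
  ι := Fin n
  fin := inferInstance
  e := Equiv.refl _

instance crdProd (M α β : Type u) [Crd M α] [Crd M β] : Crd M (α × β) where
  ι := Crd.ι M α ⊕ Crd.ι M β
  fin := inferInstance
  e := (Equiv.prodCongr Crd.e Crd.e).trans (Equiv.sumArrowEquivProdArrow _ _ _).symm

instance crdUnit (M : Type u) : Crd M PUnit.{u+1} where
  ι := Empty
  fin := inferInstance
  e := ⟨fun _ x => x.elim, fun _ => PUnit.unit, fun _ => rfl, fun f => by funext x; exact x.elim⟩

section
variable (L : FirstOrder.Language.{v, w}) (M : Type u) [L.Structure M]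

class DefP {α : Type u} [Crd M α] (P : α → Prop) : Prop where
  out : (univ : Set M).Definable L {x : Crd.ι M α → M | P (Crd.e.symm x)}

class DefS {α : Type u} [Crd M α] (s : Set α) : Prop where
  out : DefP L M (fun a => a ∈ s)

class DefF {α β : Type u} [Crd M α] [Crd M β] (f : α → β) : Prop where
  out : ∀ i : Crd.ι M β, (univ : Set M).DefinableFun L
    (fun x : Crd.ι M α → M => Crd.e (f (Crd.e.symm x)) i)

variable {L M}
variable {α β γ : Type u} [Crd M α] [Crd M β] [Crd M γ]

instance (priority := 1200) DefF.id' : DefF L M (fun a : α => a) := ⟨fun i => by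
  simp only [Equiv.apply_symm_apply]; exact DefinableFun.proj L⟩

instance DefF.const' (b : β) : DefF L M (fun _ : α => b) := ⟨fun i => by
  exact FirstOrder.Language.definableFun_const L _ (mem_univ _)⟩

instance (priority := 100) DefF.pair {f : α → β} {g : α → γ} [hf : DefF L M f] [hg : DefF L M g] :
    DefF L M (fun a => (f a, g a)) := ⟨fun i => by
  rcases i with i | i
  · exact hf.out i
  · exact hg.out i⟩

instance (priority := 1200) DefF.fst0 : DefF L M (Prod.fst : β × γ → β) := ⟨fun i => by
  exact (DefF.id' (L := L) (M := M) (α := β × γ)).out (Sum.inl i)⟩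

instance (priority := 1200) DefF.snd0 : DefF L M (Prod.snd : β × γ → γ) := ⟨fun i => by
  exact (DefF.id' (L := L) (M := M) (α := β × γ)).out (Sum.inr i)⟩

instance DefF.mkL (b : β) : DefF L M (Prod.mk b : γ → β × γ) :=
  DefF.pair (f := fun _ => b) (g := fun c => c)

instance DefF.fst' {f : α → β × γ} [hf : DefF L M f] : DefF L M (fun a => (f a).1) := ⟨fun i => by
  exact hf.out (Sum.inl i)⟩

instance DefF.snd' {f : α → β × γ} [hf : DefF L M f] : DefF L M (fun a => (f a).2) := ⟨fun i => by
  exact hf.out (Sum.inr i)⟩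

instance DefF.coord {n : ℕ} {f : α → (Fin n → M)} [hf : DefF L M f] (i : Fin n) :
    DefF L M (fun a => (f a) i) := ⟨fun _ => by
  exact hf.out i⟩

theorem DefF.mkFin {n : ℕ} {f : α → (Fin n → M)} (h : ∀ i, DefF L M (fun a => f a i)) :
    DefF L M f := ⟨fun i => (h i).out ()⟩

theorem DefP.comp {P : β → Prop} (hP : DefP L M P) {f : α → β} (hf : DefF L M f) :
    DefP L M (fun a => P (f a)) := ⟨by
  have h := hP.out.preimage_map (F := fun x => Crd.e (f (Crd.e.symm x))) (fun i => hf.out i)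
  convert h using 1
  ext x
  simp⟩

theorem DefF.comp {g : β → γ} (hg : DefF L M g) {f : α → β} (hf : DefF L M f) :
    DefF L M (fun a => g (f a)) := ⟨fun i => by
  have h := DefinableFun.comp (g := fun x => Crd.e (f (Crd.e.symm x))) (fun i => hf.out i) (hg.out i)
  simpa using h⟩

instance DefP.mem {X : Set β} [hX : DefS L M X] {f : α → β} [hf : DefF L M f] :
    DefP L M (fun a => f a ∈ X) := DefP.comp hX.out hf

instance DefP.mem0 {X : Set β} [hX : DefS L M X] :
    DefP L M (Membership.mem X) := hX.out

instance DefS.mk' {P : α → Prop} [h : DefP L M P] : DefS L M {a | P a} := ⟨h⟩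

instance DefP.and {P Q : α → Prop} [hP : DefP L M P] [hQ : DefP L M Q] :
    DefP L M (fun a => P a ∧ Q a) := ⟨hP.out.inter hQ.out⟩

instance DefP.or {P Q : α → Prop} [hP : DefP L M P] [hQ : DefP L M Q] :
    DefP L M (fun a => P a ∨ Q a) := ⟨hP.out.union hQ.out⟩

instance DefP.not {P : α → Prop} [hP : DefP L M P] :
    DefP L M (fun a => ¬ P a) := ⟨hP.out.compl⟩

instance DefP.const {p : Prop} : DefP L M (fun _ : α => p) := ⟨by
  by_cases h : p
  · convert definable_univ (M := M) using 1
    ext; simp [h]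
  · convert definable_empty (M := M) using 1
    ext; simp [h]⟩

theorem DefP.congr {P Q : α → Prop} (h : DefP L M P) (e : ∀ a, Q a ↔ P a) : DefP L M Q := by
  have : Q = P := funext fun a => propext (e a)
  exact this ▸ h

instance DefP.imp {P Q : α → Prop} [hP : DefP L M P] [hQ : DefP L M Q] :
    DefP L M (fun a => P a → Q a) :=
  DefP.congr (inferInstance : DefP L M (fun a => ¬ P a ∨ Q a)) (fun _ => imp_iff_not_or)

instance DefP.iff {P Q : α → Prop} [hP : DefP L M P] [hQ : DefP L M Q] :
    DefP L M (fun a => (P a ↔ Q a)) :=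
  DefP.congr (inferInstance : DefP L M (fun a => (P a → Q a) ∧ (Q a → P a))) (fun _ => iff_def)

instance DefP.ex {P : α → β → Prop} [hP : DefP L M (fun p : α × β => P p.1 p.2)] :
    DefP L M (fun a => ∃ b, P a b) := ⟨by
  have h := Definable.exists_of_finite hP.out
  convert h using 1
  ext x
  constructor
  · rintro ⟨b, hb⟩
    refine ⟨Crd.e b, ?_⟩
    change P (Crd.e.symm x) (Crd.e.symm (Crd.e b))
    rwa [Equiv.symm_apply_apply]
  · rintro ⟨b, hb⟩
    exact ⟨Crd.e.symm b, hb⟩⟩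

instance DefP.all {P : α → β → Prop} [hP : DefP L M (fun p : α × β => P p.1 p.2)] :
    DefP L M (fun a => ∀ b, P a b) :=
  DefP.congr (inferInstance : DefP L M (fun a => ¬ ∃ b, ¬ P a b)) (fun a => by simp)

instance DefP.eqM {f g : α → M} [hf : DefF L M f] [hg : DefF L M g] :
    DefP L M (fun a => f a = g a) := ⟨by
  exact DefinableFun.ofPred_eq (hf.out ()) (hg.out ())⟩

instance DefP.eqM0 (b : M) : DefP L M (Eq b) :=
  DefP.eqM (f := fun _ => b) (g := fun a => a)

theorem DefP.exFin {ι : Type*} [Finite ι] {P : ι → α → Prop} (h : ∀ i, DefP L M (P i)) :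
    DefP L M (fun a => ∃ i, P i a) := ⟨by
  convert definable_iUnion_of_finite (fun i => (h i).out) using 1
  ext x; simp⟩

theorem DefP.allFin {ι : Type*} [Finite ι] {P : ι → α → Prop} (h : ∀ i, DefP L M (P i)) :
    DefP L M (fun a => ∀ i, P i a) := ⟨by
  convert definable_iInter_of_finite (fun i => (h i).out) using 1
  ext x; simp⟩

theorem DefP.sect {P : α → β → Prop} (h : DefP L M (fun p : α × β => P p.1 p.2)) (a : α) :
    DefP L M (P a) := h.comp (f := fun b => (a, b)) inferInstance

variable (L M) in
theorem exSet (P : α → Prop) [h : DefP L M P] : ∃ X : Set α, DefS L M X ∧ P = fun a => a ∈ X :=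
  ⟨{a | P a}, ⟨h⟩, rfl⟩

variable (L M) in
theorem exSet2 (P : α → β → Prop) [h : DefP L M (fun p : α × β => P p.1 p.2)] :
    ∃ X : Set (α × β), DefS L M X ∧ P = fun a b => (a, b) ∈ X :=
  ⟨{p | P p.1 p.2}, ⟨h⟩, rfl⟩

variable (L M) in
theorem exSet3 (P : α → β → γ → Prop) [h : DefP L M (fun p : (α × β) × γ => P p.1.1 p.1.2 p.2)] :
    ∃ X : Set ((α × β) × γ), DefS L M X ∧ P = fun a b c => ((a, b), c) ∈ X :=
  ⟨{p | P p.1.1 p.1.2 p.2}, ⟨h⟩, rfl⟩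

end

class OMin (L : FirstOrder.Language.{v, w}) (M : Type u) [L.Structure M] [LinearOrder M] : Prop where
  lt_def : (univ : Set M).Definable L {v : Fin 2 → M | v 0 < v 1}
  omin : ∀ s : Set M, Set.Definable₁ (Set.univ : Set M) L s →
    ∃ F : Finset (Set M), s = ⋃₀ (F : Set (Set M)) ∧
      ∀ t ∈ F, (∃ a : M, t = {a}) ∨ (∃ a b : M, t = Set.Ioo a b) ∨
        (∃ a : M, t = Set.Ioi a) ∨ (∃ a : M, t = Set.Iio a) ∨ t = Set.univ

section
variable {L : FirstOrder.Language.{v, w}} {M : Type u} [L.Structure M] [LinearOrder M] [OMin L M]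
variable {α β γ : Type u} [Crd M α] [Crd M β] [Crd M γ]

instance DefP.lt {f g : α → M} [hf : DefF L M f] [hg : DefF L M g] :
    DefP L M (fun a => f a < g a) := by
  have h : DefP L M (fun v : Fin 2 → M => v 0 < v 1) := ⟨OMin.lt_def⟩
  have := h.comp (f := fun a => (![f a, g a] : Fin 2 → M)) (DefF.mkFin (fun i => by
    fin_cases i
    · exact hf
    · exact hg))
  simpa using this

instance DefP.le {f g : α → M} [hf : DefF L M f] [hg : DefF L M g] :
    DefP L M (fun a => f a ≤ g a) :=
  DefP.congr (inferInstance : DefP L M (fun a => ¬ g a < f a)) (fun a => by simp)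

instance DefP.lt0 (b : M) : DefP L M (LT.lt b) :=
  DefP.lt (f := fun _ => b) (g := fun a => a)

instance DefP.le0 (b : M) : DefP L M (LE.le b) :=
  DefP.le (f := fun _ => b) (g := fun a => a)

/-- contains an open interval -/
def Big (P : M → Prop) : Prop := ∃ a b : M, a < b ∧ ∀ z, a < z → z < b → P z

instance DefP.big {P : α → M → Prop} [hP : DefP L M (fun p : α × M => P p.1 p.2)] :
    DefP L M (fun a => Big (fun z => P a z)) := by
  obtain ⟨X, hX, rfl⟩ := exSet2 L M P
  unfold Big
  beta_reduce
  infer_instance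


end

end OM


open FirstOrder Set

set_option linter.unusedSectionVars false
set_option linter.unusedVariables false

namespace OM
universe u v w
section
variable (L : FirstOrder.Language.{v, w}) {M : Type u} [L.Structure M] [LinearOrder M] [OMin L M]
  [DenselyOrdered M] [NoMinOrder M] [NoMaxOrder M] [Nonempty M]

theorem omin_ind (C : (M → Prop) → Prop) (h0 : C (fun _ => False))
    (hu : ∀ P Q, C P → C Q → C (fun x => P x ∨ Q x)) (h1 : ∀ a, C (fun x => x = a))
    (h2 : ∀ a b, a < b → C (fun x => a < x ∧ x < b)) (h3 : ∀ a, C (fun x => a < x))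
    (h4 : ∀ a, C (fun x => x < a)) (h5 : C (fun _ => True))
    (P : M → Prop) [hP : DefP L M P] : C P := by
  have hd : Set.Definable₁ (Set.univ : Set M) L {x | P x} :=
    (hP.comp (f := fun x : Fin 1 → M => x 0) inferInstance).out
  obtain ⟨F, hF, hF'⟩ := OMin.omin {x | P x} hd
  have key : ∀ G : Finset (Set M), (∀ t ∈ G, C (fun x => x ∈ t)) →
      C (fun x => x ∈ ⋃₀ (G : Set (Set M))) := by
    intro G
    classical
    induction G using Finset.induction_on with
    | empty => intro _; simpa using h0
    | insert t G ht ih =>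
      intro h
      have a1 := h t (by simp)
      have a2 := ih (fun t' ht' => h t' (by simp [ht']))
      have := hu _ _ a1 a2
      simpa using this
  have := key F (by
    intro t ht
    rcases hF' t ht with ⟨a, rfl⟩ | ⟨a, b, rfl⟩ | ⟨a, rfl⟩ | ⟨a, rfl⟩ | rfl
    · simpa using h1 a
    · by_cases hab : a < b
      · simpa using h2 a b hab
      · simpa [Set.Ioo_eq_empty hab] using h0
    · simpa using h3 a
    · simpa using h4 a
    · simpa using h5)
  rw [← hF] at this
  exact this

theorem exbt {a b : M} (h : a < b) : ∃ c, a < c ∧ c < b := exists_between h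

theorem big_or_fin (P : M → Prop) [DefP L M P] : Big P ∨ {x | P x}.Finite := by
  apply omin_ind L (fun P => Big P ∨ {x | P x}.Finite)
  · right; simp
  · rintro P Q (⟨a, b, hab, h⟩ | hP) (⟨a', b', hab', h'⟩ | hQ)
    · exact Or.inl ⟨a, b, hab, fun z h1 h2 => Or.inl (h z h1 h2)⟩
    · exact Or.inl ⟨a, b, hab, fun z h1 h2 => Or.inl (h z h1 h2)⟩
    · exact Or.inl ⟨a', b', hab', fun z h1 h2 => Or.inr (h' z h1 h2)⟩
    · exact Or.inr (hP.union hQ)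
  · intro a; right; simp
  · intro a b hab; exact Or.inl ⟨a, b, hab, fun z h1 h2 => ⟨h1, h2⟩⟩
  · intro a; obtain ⟨b, hb⟩ := exists_gt a
    exact Or.inl ⟨a, b, hb, fun z h1 h2 => h1⟩
  · intro a; obtain ⟨b, hb⟩ := exists_lt a
    exact Or.inl ⟨b, a, hb, fun z h1 h2 => h2⟩
  · obtain ⟨a⟩ := ‹Nonempty M›
    obtain ⟨b, hb⟩ := exists_lt a
    exact Or.inl ⟨b, a, hb, fun z h1 h2 => trivial⟩

theorem Big.inf {P : M → Prop} (h : Big P) : {x | P x}.Infinite := by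
  obtain ⟨a, b, hab, h⟩ := h
  exact (Set.Ioo_infinite hab).mono (fun z hz => h z hz.1 hz.2)

theorem Big.mono {P Q : M → Prop} (h : Big P) (hPQ : ∀ x, P x → Q x) : Big Q := by
  obtain ⟨a, b, hab, h⟩ := h
  exact ⟨a, b, hab, fun z h1 h2 => hPQ z (h z h1 h2)⟩

theorem big_of_inf (P : M → Prop) [DefP L M P] (h : {x | P x}.Infinite) : Big P :=
  (big_or_fin L P).resolve_right h

theorem fin_of_not_big (P : M → Prop) [DefP L M P] (h : ¬ Big P) : {x | P x}.Finite :=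
  (big_or_fin L P).resolve_left h

theorem Big.or {P Q : M → Prop} [DefP L M P] [DefP L M Q] (h : Big (fun x => P x ∨ Q x)) :
    Big P ∨ Big Q := by
  by_contra! hc
  have h1 := fin_of_not_big L P hc.1
  have h2 := fin_of_not_big L Q hc.2
  exact h.inf (h1.union h2)

theorem germ_right (P : M → Prop) [DefP L M P] (c : M) :
    (∃ d, c < d ∧ ∀ z, c < z → z < d → P z) ∨ (∃ d, c < d ∧ ∀ z, c < z → z < d → ¬ P z) := by
  obtain ⟨d0, hd0⟩ := exists_gt c
  apply omin_ind L (fun P => (∃ d, c < d ∧ ∀ z, c < z → z < d → P z) ∨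
    (∃ d, c < d ∧ ∀ z, c < z → z < d → ¬ P z))
  · right; exact ⟨d0, hd0, by simp⟩
  · rintro P Q (⟨d, hd, h⟩ | ⟨d, hd, h⟩) hQ
    · left; exact ⟨d, hd, fun z h1 h2 => Or.inl (h z h1 h2)⟩
    · rcases hQ with (⟨d', hd', h'⟩ | ⟨d', hd', h'⟩)
      · left; exact ⟨d', hd', fun z h1 h2 => Or.inr (h' z h1 h2)⟩
      · right; refine ⟨min d d', lt_min hd hd', fun z h1 h2 => ?_⟩
        have := h z h1 (lt_of_lt_of_le h2 (min_le_left _ _))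
        have := h' z h1 (lt_of_lt_of_le h2 (min_le_right _ _))
        tauto
  · intro a
    right
    by_cases hca : c < a
    · exact ⟨a, hca, fun z h1 h2 => h2.ne⟩
    · exact ⟨d0, hd0, fun z h1 h2 => (lt_of_le_of_lt (not_lt.1 hca) h1).ne'⟩
  · intro a b hab
    by_cases hca : c < a
    · right; exact ⟨a, hca, fun z h1 h2 h3 => absurd h2 h3.1.asymm⟩
    · by_cases hcb : c < b
      · left; exact ⟨b, hcb, fun z h1 h2 => ⟨lt_of_le_of_lt (not_lt.1 hca) h1, h2⟩⟩
      · right; exact ⟨d0, hd0, fun z h1 h2 h3 => hcb (h1.trans h3.2)⟩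
  · intro a
    by_cases hca : c < a
    · right; exact ⟨a, hca, fun z h1 h2 h3 => absurd h2 h3.asymm⟩
    · left; exact ⟨d0, hd0, fun z h1 h2 => lt_of_le_of_lt (not_lt.1 hca) h1⟩
  · intro b
    by_cases hcb : c < b
    · left; exact ⟨b, hcb, fun z h1 h2 => h2⟩
    · right; exact ⟨d0, hd0, fun z h1 h2 h3 => hcb (h1.trans h3)⟩
  · left; exact ⟨d0, hd0, by simp⟩

theorem germ_left (P : M → Prop) [DefP L M P] (c : M) :
    (∃ d, d < c ∧ ∀ z, d < z → z < c → P z) ∨ (∃ d, d < c ∧ ∀ z, d < z → z < c → ¬ P z) := by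
  obtain ⟨d0, hd0⟩ := exists_lt c
  apply omin_ind L (fun P => (∃ d, d < c ∧ ∀ z, d < z → z < c → P z) ∨
    (∃ d, d < c ∧ ∀ z, d < z → z < c → ¬ P z))
  · right; exact ⟨d0, hd0, by simp⟩
  · rintro P Q (⟨d, hd, h⟩ | ⟨d, hd, h⟩) hQ
    · left; exact ⟨d, hd, fun z h1 h2 => Or.inl (h z h1 h2)⟩
    · rcases hQ with (⟨d', hd', h'⟩ | ⟨d', hd', h'⟩)
      · left; exact ⟨d', hd', fun z h1 h2 => Or.inr (h' z h1 h2)⟩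
      · right; refine ⟨max d d', max_lt hd hd', fun z h1 h2 => ?_⟩
        have := h z (lt_of_le_of_lt (le_max_left _ _) h1) h2
        have := h' z (lt_of_le_of_lt (le_max_right _ _) h1) h2
        tauto
  · intro a
    right
    by_cases hca : a < c
    · exact ⟨a, hca, fun z h1 h2 => h1.ne'⟩
    · exact ⟨d0, hd0, fun z h1 h2 => (lt_of_lt_of_le h2 (not_lt.1 hca)).ne⟩
  · intro a b hab
    by_cases hcb : b < c
    · right; exact ⟨b, hcb, fun z h1 h2 h3 => absurd h1 h3.2.asymm⟩
    · by_cases hca : a < c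
      · left; exact ⟨a, hca, fun z h1 h2 => ⟨h1, lt_of_lt_of_le h2 (not_lt.1 hcb)⟩⟩
      · right; exact ⟨d0, hd0, fun z h1 h2 h3 => hca (h3.1.trans h2)⟩
  · intro a
    by_cases hca : a < c
    · left; exact ⟨a, hca, fun z h1 h2 => h1⟩
    · right; exact ⟨d0, hd0, fun z h1 h2 h3 => hca (h3.trans h2)⟩
  · intro b
    by_cases hcb : b < c
    · right; exact ⟨b, hcb, fun z h1 h2 h3 => absurd h1 h3.asymm⟩
    · left; exact ⟨d0, hd0, fun z h1 h2 => lt_of_lt_of_le h2 (not_lt.1 hcb)⟩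
  · left; exact ⟨d0, hd0, by simp⟩

theorem germ_bot (P : M → Prop) [DefP L M P] :
    (∃ d, ∀ z, z < d → P z) ∨ (∃ d, ∀ z, z < d → ¬ P z) := by
  obtain ⟨d0⟩ := ‹Nonempty M›
  apply omin_ind L (fun P => (∃ d, ∀ z, z < d → P z) ∨ (∃ d, ∀ z, z < d → ¬ P z))
  · right; exact ⟨d0, by simp⟩
  · rintro P Q (⟨d, h⟩ | ⟨d, h⟩) hQ
    · left; exact ⟨d, fun z h1 => Or.inl (h z h1)⟩
    · rcases hQ with (⟨d', h'⟩ | ⟨d', h'⟩)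
      · left; exact ⟨d', fun z h1 => Or.inr (h' z h1)⟩
      · right; refine ⟨min d d', fun z h2 => ?_⟩
        have := h z (lt_of_lt_of_le h2 (min_le_left _ _))
        have := h' z (lt_of_lt_of_le h2 (min_le_right _ _))
        tauto
  · intro a; right; exact ⟨a, fun z h => h.ne⟩
  · intro a b hab; right; exact ⟨a, fun z h h' => h.asymm h'.1⟩
  · intro a; right; exact ⟨a, fun z h h' => h.asymm h'⟩
  · intro a; left; exact ⟨a, fun z h => h⟩
  · left; exact ⟨d0, by simp⟩

theorem ex_lub (P : M → Prop) [DefP L M P] (hne : ∃ x, P x) (hb : ∃ b, ∀ x, P x → x ≤ b) :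
    ∃ s, IsLUB {x | P x} s := by
  revert hne hb
  apply omin_ind L (fun P => (∃ x, P x) → (∃ b, ∀ x, P x → x ≤ b) → ∃ s, IsLUB {x | P x} s)
  · rintro ⟨x, hx⟩; exact hx.elim
  · rintro P Q hP hQ hne ⟨b, hb⟩
    by_cases h1 : ∃ x, P x
    · obtain ⟨s, hs⟩ := hP h1 ⟨b, fun x hx => hb x (Or.inl hx)⟩
      by_cases h2 : ∃ x, Q x
      · obtain ⟨t, ht⟩ := hQ h2 ⟨b, fun x hx => hb x (Or.inr hx)⟩
        exact ⟨s ⊔ t, hs.union ht⟩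
      · push Not at h2
        exact ⟨s, by simpa [h2] using hs⟩
    · push Not at h1
      obtain ⟨t, ht⟩ := hQ (by simpa [h1] using hne) ⟨b, fun x hx => hb x (Or.inr hx)⟩
      exact ⟨t, by simpa [h1] using ht⟩
  · intro a _ _; exact ⟨a, by simp⟩
  · intro a b hab _ _; exact ⟨b, isLUB_Ioo hab⟩
  · rintro a _ ⟨b, hb⟩
    obtain ⟨c, hc⟩ := exists_gt (max a b)
    exact absurd (hb c (lt_of_le_of_lt (le_max_left _ _) hc)) (not_le.2 (lt_of_le_of_lt (le_max_right _ _) hc))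
  · intro a _ _; exact ⟨a, isLUB_Iio⟩
  · rintro _ ⟨b, hb⟩
    obtain ⟨c, hc⟩ := exists_gt b
    exact absurd (hb c trivial) (not_le.2 hc)

theorem ex_glb (P : M → Prop) [DefP L M P] (hne : ∃ x, P x) (hb : ∃ b, ∀ x, P x → b ≤ x) :
    ∃ s, IsGLB {x | P x} s := by
  obtain ⟨b, hb⟩ := hb
  obtain ⟨x, hx⟩ := hne
  obtain ⟨X, hX, rfl⟩ := exSet L M P
  obtain ⟨s, hs⟩ := ex_lub L (fun y => ∀ x, x ∈ X → y ≤ x) ⟨b, hb⟩ ⟨x, fun y hy => hy x hx⟩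
  refine ⟨s, ⟨fun y hy => hs.2 fun z hz => hz y hy, fun y hy => hs.1 fun z hz => hy hz⟩⟩

/-- boundary -/
def bd (P : M → Prop) (t : M) : Prop :=
  ∀ a b, a < t → t < b → (∃ x, a < x ∧ x < b ∧ P x) ∧ (∃ x, a < x ∧ x < b ∧ ¬ P x)

instance DefP.bd {α : Type u} [Crd M α] {P : α → M → Prop} {f : α → M} [hf : DefF L M f]
    [hP : DefP L M (fun p : α × M => P p.1 p.2)] :
    DefP L M (fun a => bd (fun z => P a z) (f a)) := by
  obtain ⟨X, hX, rfl⟩ := exSet2 L M P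
  have : DefP L M (fun p : α × M => OM.bd (fun z => (p.1, z) ∈ X) p.2) := by
    unfold OM.bd
    infer_instance
  exact this.comp (f := fun a => (a, f a)) inferInstance

instance DefP.bd0 {P : M → Prop} [hP : DefP L M P] : DefP L M (OM.bd P) := by
  obtain ⟨X, hX, rfl⟩ := exSet L M P
  exact DefP.bd L (P := fun a z => z ∈ X) (f := fun a => a)

theorem bd_fin (P : M → Prop) [DefP L M P] : {x | bd P x}.Finite := by
  obtain ⟨X, hX, rfl⟩ := exSet L M P
  apply fin_of_not_big L (fun x => bd (fun z => z ∈ X) x)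
  rintro ⟨a, b, hab, h⟩
  rcases germ_right L (fun z => z ∈ X) a with ⟨d, hd, hz⟩ | ⟨d, hd, hz⟩
  · obtain ⟨t, h1, h2⟩ := exbt (lt_min hab hd)
    obtain ⟨x, hx1, hx2, hx3⟩ := (h t h1 (lt_of_lt_of_le h2 (min_le_left _ _)) a d h1
      (lt_of_lt_of_le h2 (min_le_right _ _))).2
    exact hx3 (hz x hx1 hx2)
  · obtain ⟨t, h1, h2⟩ := exbt (lt_min hab hd)
    obtain ⟨x, hx1, hx2, hx3⟩ := (h t h1 (lt_of_lt_of_le h2 (min_le_left _ _)) a d h1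
      (lt_of_lt_of_le h2 (min_le_right _ _))).1
    exact (hz x hx1 hx2) hx3

theorem bd_between (P : M → Prop) [DefP L M P] {t u : M} (htu : t < u) (h : P t ∧ ¬ P u) :
    ∃ s, t ≤ s ∧ s ≤ u ∧ bd P s := by
  obtain ⟨X, hX, rfl⟩ := exSet L M P
  obtain ⟨s, hs⟩ := ex_lub L (fun x => t ≤ x ∧ x ≤ u ∧ ∀ y, t ≤ y → y ≤ x → y ∈ X)
    ⟨t, le_rfl, htu.le, fun y h1 h2 => (le_antisymm h1 h2) ▸ h.1⟩ ⟨u, fun x hx => hx.2.1⟩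
  have hts : t ≤ s := hs.1 ⟨le_rfl, htu.le, fun y h1 h2 => (le_antisymm h1 h2) ▸ h.1⟩
  have hsu : s ≤ u := hs.2 fun x hx => hx.2.1
  refine ⟨s, hts, hsu, fun a b ha hb => ⟨?_, ?_⟩⟩
  · obtain ⟨x, hx, hax, hxs⟩ := hs.exists_between ha
    exact ⟨x, hax, lt_of_le_of_lt hxs hb, hx.2.2 x hx.1 le_rfl⟩
  · by_contra! hc
    obtain ⟨x, hx, hax, hxs⟩ := hs.exists_between ha
    have hub : b ≤ u := by
      by_contra! hlt
      exact h.2 (hc u (lt_of_lt_of_le ha hsu) hlt)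
    obtain ⟨s', h1, h2⟩ := exbt hb
    have : s' ≤ s := hs.1 ⟨hts.trans h1.le, h2.le.trans hub, fun y h3 h4 => by
      rcases le_or_gt y x with h5 | h5
      · exact hx.2.2 y h3 h5
      · exact hc y (hax.trans h5) (lt_of_le_of_lt h4 h2)⟩
    exact absurd h1 (not_lt.2 this)

theorem bd_not (P : M → Prop) (t : M) : bd (fun x => ¬ P x) t ↔ bd P t := by
  unfold bd; simp only [not_not]
  exact forall₄_congr fun a b h1 h2 => and_comm

theorem bd_between' (P : M → Prop) [DefP L M P] {t u : M} (htu : t < u) (h : ¬ (P t ↔ P u)) :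
    ∃ s, t ≤ s ∧ s ≤ u ∧ bd P s := by
  by_cases h1 : P t
  · exact bd_between L P htu ⟨h1, by tauto⟩
  · obtain ⟨s, h2, h3, h4⟩ := bd_between L (fun x => ¬ P x) htu ⟨h1, by tauto⟩
    exact ⟨s, h2, h3, (bd_not _ _).1 h4⟩

/-- shrink an interval so that P is decided -/
theorem Big.split (P Q : M → Prop) [DefP L M P] [DefP L M Q] (h : Big P) :
    Big (fun x => P x ∧ Q x) ∨ Big (fun x => P x ∧ ¬ Q x) := by
  apply Big.or L
  exact h.mono (fun x hx => by tauto)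

theorem big_exFin {ι : Type*} [Finite ι] (P : ι → M → Prop) (hP : ∀ i, DefP L M (P i))
    (h : Big (fun x => ∃ i, P i x)) : ∃ i, Big (P i) := by
  by_contra! hc
  have h1 : ∀ i, {x | P i x}.Finite := fun i => fin_of_not_big L (P i) (hc i)
  have h2 := Set.finite_iUnion h1
  refine h.inf (h2.subset ?_)
  rintro x ⟨i, hi⟩
  exact mem_iUnion.2 ⟨i, hi⟩

end
end OM


open FirstOrder Set
set_option linter.unusedSectionVars false
set_option linter.unusedVariables false

namespace OM
universe u v w
section
variable (L : FirstOrder.Language.{v, w}) {M : Type u} [L.Structure M] [LinearOrder M] [OMin L M]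
  [DenselyOrdered M] [NoMinOrder M] [NoMaxOrder M] [Nonempty M]
  {α β γ : Type u} [Crd M α] [Crd M β] [Crd M γ]

theorem fin_max {P : M → Prop} (h : {x | P x}.Finite) (hne : ∃ x, P x) :
    ∃ m, P m ∧ ∀ x, P x → x ≤ m := by
  obtain ⟨x, hx⟩ := hne
  obtain ⟨m, hm, h'⟩ := Set.exists_max_image {x | P x} id h ⟨x, hx⟩
  exact ⟨m, hm, h'⟩

theorem fin_min {P : M → Prop} (h : {x | P x}.Finite) (hne : ∃ x, P x) :
    ∃ m, P m ∧ ∀ x, P x → m ≤ x := by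
  obtain ⟨x, hx⟩ := hne
  obtain ⟨m, hm, h'⟩ := Set.exists_min_image {x | P x} id h ⟨x, hx⟩
  exact ⟨m, hm, h'⟩

theorem fin_above {P : M → Prop} (h : {x | P x}.Finite) {a b : M} (hab : a < b)
    (hP : ∀ x, P x → x < b) : ∃ c, a < c ∧ c < b ∧ ∀ x, P x → x < c := by
  by_cases hne : ∃ x, P x
  · obtain ⟨m, hm, h'⟩ := fin_max h hne
    obtain ⟨c, h1, h2⟩ := exbt (max_lt hab (hP m hm))
    exact ⟨c, lt_of_le_of_lt (le_max_left _ _) h1, h2, fun x hx =>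
      lt_of_le_of_lt ((h' x hx).trans (le_max_right _ _)) h1⟩
  · obtain ⟨c, h1, h2⟩ := exbt hab
    exact ⟨c, h1, h2, fun x hx => absurd ⟨x, hx⟩ hne⟩

theorem fin_below {P : M → Prop} (h : {x | P x}.Finite) {a b : M} (hab : a < b)
    (hP : ∀ x, P x → a < x) : ∃ c, a < c ∧ c < b ∧ ∀ x, P x → c < x := by
  by_cases hne : ∃ x, P x
  · obtain ⟨m, hm, h'⟩ := fin_min h hne
    obtain ⟨c, h1, h2⟩ := exbt (lt_min hab (hP m hm))
    exact ⟨c, h1, lt_of_lt_of_le h2 (min_le_left _ _), fun x hx =>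
      lt_of_lt_of_le h2 ((min_le_right _ _).trans (h' x hx))⟩
  · obtain ⟨c, h1, h2⟩ := exbt hab
    exact ⟨c, h1, h2, fun x hx => absurd ⟨x, hx⟩ hne⟩

theorem lemQ (E : M → β → Prop) [DefP L M (fun p : M × β => E p.1 p.2)]
    (hn : ∀ y y', (∀ x, E x y → E x y') ∨ (∀ x, E x y' → E x y))
    (hB : Big (fun x => ∃ y, E x y)) : ∃ y, Big (fun x => E x y) := by
  obtain ⟨X, hX, rfl⟩ := exSet2 L M E
  by_contra! hc
  have hfin : ∀ y, {x | (x, y) ∈ X}.Finite := fun y => fin_of_not_big L (fun x => (x, y) ∈ X) (hc y)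
  obtain ⟨a, b, hab, h⟩ := hB
  have hK : Big (fun x => a < x ∧ x < b ∧
      ∃ y, (x, y) ∈ X ∧ ∀ x', a < x' → x' < b → (x', y) ∈ X → x' ≤ x) := by
    apply big_of_inf L
    intro hfinK
    obtain ⟨x0, h1, h2, h3⟩ := fin_above hfinK hab (fun x hx => hx.2.1)
    obtain ⟨y, hy⟩ := h x0 h1 h2
    obtain ⟨m, hm, hm'⟩ := fin_max (P := fun x => a < x ∧ x < b ∧ (x, y) ∈ X)
      ((hfin y).subset (fun x hx => hx.2.2)) ⟨x0, h1, h2, hy⟩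
    have := h3 m ⟨hm.1, hm.2.1, y, hm.2.2, fun x' h1 h2 h3 => hm' x' ⟨h1, h2, h3⟩⟩
    exact absurd (hm' x0 ⟨h1, h2, hy⟩) (not_le.2 this)
  obtain ⟨p, q, hpq, hK⟩ := hK
  obtain ⟨x2, h1, h2⟩ := exbt hpq
  obtain ⟨ha, hb, y2, hy2, -⟩ := hK x2 h1 h2
  apply hc y2
  refine ⟨p, x2, h1, fun x hx1 hx2 => ?_⟩
  obtain ⟨ha', hb', y, hy, hmax⟩ := hK x hx1 (hx2.trans h2)
  have hne : (x2, y) ∉ X := fun hh => absurd (hmax x2 ha hb hh) (not_le.2 hx2)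
  rcases hn y y2 with h' | h'
  · exact h' x hy
  · exact absurd (h' x2 hy2) hne

theorem lemR (ρ : M → M → Prop) [DefP L M (fun p : M × M => ρ p.1 p.2)] {a b : M} (hab : a < b)
    (h : ∀ x, a < x → x < b → ∃ z, x < z ∧ ∀ y, x < y → y < z → ρ x y) :
    ∃ p q, p < q ∧ ∀ x, p < x → x < q → a < x ∧ x < b ∧ ∀ y, x < y → y < q → ρ x y := by
  obtain ⟨X, hX, rfl⟩ := exSet2 L M ρ
  obtain ⟨A, hA⟩ : ∃ A : Set (M × M), A = {p | a < p.1 ∧ p.1 < p.2 ∧ p.2 < b ∧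
    ∀ y, p.1 < y → y < p.2 → (p.1, y) ∈ X} := ⟨_, rfl⟩
  have hAd : DefS L M A := by rw [hA]; infer_instance
  have hAi : ∀ x z, (x, z) ∈ A ↔ (a < x ∧ x < z ∧ z < b ∧ ∀ y, x < y → y < z → (x, y) ∈ X) := by
    intro x z; rw [hA]; rfl
  have fin : ∀ z, Big (fun x => (x, z) ∈ A) → ∃ p q, p < q ∧ ∀ x, p < x → x < q →
      a < x ∧ x < b ∧ ∀ y, x < y → y < q → (x, y) ∈ X := by
    rintro z ⟨p, q, hpq, h'⟩
    refine ⟨p, q, hpq, fun x h1 h2 => ?_⟩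
    have h3 := (hAi _ _).1 (h' x h1 h2)
    refine ⟨h3.1, h3.2.1.trans h3.2.2.1, fun y hy1 hy2 => h3.2.2.2 y hy1 ?_⟩
    exact ((hAi _ _).1 (h' y (h1.trans hy1) hy2)).2.1
  by_contra hcon
  have hc : ∀ z, ¬ Big (fun x => (x, z) ∈ A) := fun z hz => hcon (fin z hz)
  have hK : Big (fun x => ∃ z, (x, z) ∈ A ∧ ∀ x', (x', z) ∈ A → x ≤ x') := by
    apply big_of_inf L
    intro hfin
    obtain ⟨x0, h1, h2, h3⟩ := fin_below hfin hab (fun x ⟨z, hz, _⟩ => ((hAi _ _).1 hz).1)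
    obtain ⟨z', hz', hz⟩ := h x0 h1 h2
    obtain ⟨z, hz1, hz2⟩ := exbt (lt_min hz' h2)
    have hin : (x0, z) ∈ A := (hAi _ _).2 ⟨h1, hz1, lt_of_lt_of_le hz2 (min_le_right _ _),
      fun y hy1 hy2 => hz y hy1 (hy2.trans (lt_of_lt_of_le hz2 (min_le_left _ _)))⟩
    obtain ⟨m, hm, hm'⟩ := fin_min (fin_of_not_big L (fun x => (x, z) ∈ A) (hc z)) ⟨x0, hin⟩
    exact absurd (hm' x0 hin) (not_le.2 (h3 m ⟨z, hm, hm'⟩))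
  obtain ⟨p, q, hpq, hK⟩ := hK
  obtain ⟨x1, h1, h2⟩ := exbt hpq
  obtain ⟨z, hz, -⟩ := hK x1 h1 h2
  rw [hAi] at hz
  obtain ⟨z1, h3, h4⟩ := exbt (lt_min h2 hz.2.1)
  have h4a := lt_of_lt_of_le h4 (min_le_left _ _)
  have h4b := lt_of_lt_of_le h4 (min_le_right _ _)
  apply hc z1
  refine ⟨x1, z1, h3, fun x hx1 hx2 => ?_⟩
  obtain ⟨y, hy, hymin⟩ := hK x (h1.trans hx1) (hx2.trans h4a)
  have hny : (x1, y) ∉ A := fun hh => absurd (hymin x1 hh) (not_le.2 hx1)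
  rw [hAi] at hny hy
  have hyz : z1 < y := by
    by_contra! hle
    exact hny ⟨hz.1, hx1.trans hy.2.1, hy.2.2.1, fun t ht1 ht2 =>
      hz.2.2.2 t ht1 (ht2.trans (lt_of_le_of_lt hle h4b))⟩
  exact (hAi _ _).2 ⟨hy.1, hx2, h4b.trans hz.2.2.1, fun t ht1 ht2 => hy.2.2.2 t ht1 (ht2.trans hyz)⟩

theorem fubini (A : M → M → Prop) [DefP L M (fun p : M × M => A p.1 p.2)]
    (hB : Big (fun x => Big (fun y => A x y))) : Big (fun y => Big (fun x => A x y)) := by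
  obtain ⟨X, hX, rfl⟩ := exSet2 L M A
  obtain ⟨R, hR⟩ : ∃ R : Set (M × M), R = {p | (∃ d, p.2 < d ∧ ∀ y, p.2 < y → y < d → (p.1, y) ∈ X) ∧
    ¬ ∃ e, e < p.2 ∧ ∀ y, e < y → y ≤ p.2 → (p.1, y) ∈ X} := ⟨_, rfl⟩
  have hRd : DefS L M R := by rw [hR]; infer_instance
  have hRi : ∀ x c, (x, c) ∈ R ↔ ((∃ d, c < d ∧ ∀ y, c < y → y < d → (x, y) ∈ X) ∧
    ¬ ∃ e, e < c ∧ ∀ y, e < y → y ≤ c → (x, y) ∈ X) := by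
    intro x z; rw [hR]; rfl
  have hfin : ∀ x, {c | (x, c) ∈ R}.Finite := by
    intro x
    apply (bd_fin L (fun y => (x, y) ∈ X)).subset
    intro c hc a b ha hb
    obtain ⟨⟨d, hd, h1⟩, h2⟩ := (hRi _ _).1 hc
    constructor
    · obtain ⟨y, hy1, hy2⟩ := exbt (lt_min hd hb)
      exact ⟨y, ha.trans hy1, lt_of_lt_of_le hy2 (min_le_right _ _),
        h1 y hy1 (lt_of_lt_of_le hy2 (min_le_left _ _))⟩
    · push Not at h2
      obtain ⟨y, hy1, hy2, hy3⟩ := h2 a ha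
      exact ⟨y, hy1, lt_of_le_of_lt hy2 hb, hy3⟩
  have hcase : ∀ x, Big (fun y => (x, y) ∈ X) →
      (∃ c, (x, c) ∈ R) ∨ (∃ y, ∀ z, z < y → (x, z) ∈ X) := by
    rintro x ⟨a, b, hab, h⟩
    by_cases hbd : ∃ l, ∀ t, (t < b ∧ ∀ y, t < y → y < b → (x, y) ∈ X) → l ≤ t
    · left
      obtain ⟨c, hc⟩ := ex_glb L (fun t => t < b ∧ ∀ y, t < y → y < b → (x, y) ∈ X) ⟨a, hab, h⟩ hbd
      have hca : c ≤ a := hc.1 ⟨hab, h⟩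
      have hcb : ∀ y, c < y → y < b → (x, y) ∈ X := by
        intro y h1 h2
        obtain ⟨t, ht, _, ht'⟩ := hc.exists_between h1
        exact ht.2 y ht' h2
      refine ⟨c, (hRi _ _).2 ⟨⟨b, lt_of_le_of_lt hca hab, hcb⟩, ?_⟩⟩
      rintro ⟨e, he, h'⟩
      refine absurd (hc.1 (⟨he.trans (lt_of_le_of_lt hca hab), fun y h1 h2 => ?_⟩ :
        e < b ∧ ∀ y, e < y → y < b → (x, y) ∈ X)) (not_le.2 he)
      rcases le_or_gt y c with h3 | h3
      · exact h' y h1 h3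
      · exact hcb y h3 h2
    · right
      push Not at hbd
      refine ⟨b, fun z hz => ?_⟩
      obtain ⟨t, ht, htz⟩ := hbd z
      exact ht.2 z htz hz
  have hB' := Big.or L (hB.mono hcase)
  rcases hB' with hB1 | hB2
  · by_cases hY : Big (fun c => ∃ x, (x, c) ∈ R)
    · obtain ⟨a, b, hab, hY⟩ := hY
      obtain ⟨p, q, hpq, h⟩ := lemR L (fun c y => ∃ x, (x, c) ∈ R ∧ (x, y) ∈ X) hab (by
        intro c h1 h2
        obtain ⟨x, hx⟩ := hY c h1 h2
        obtain ⟨⟨d, hd, h1⟩, h2⟩ := (hRi _ _).1 hx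
        exact ⟨d, hd, fun y h3 h4 => ⟨x, hx, h1 y h3 h4⟩⟩)
      refine ⟨p, q, hpq, fun y hy1 hy2 => ?_⟩
      apply big_of_inf L
      intro hf
      have := hf.biUnion (fun x _ => hfin x)
      refine Set.Ioo_infinite hy1 (this.subset ?_)
      intro c hc
      obtain ⟨x, hx1, hx2⟩ := (h c hc.1 (hc.2.trans hy2)).2.2 y hc.2 hy2
      exact mem_biUnion hx2 hx1
    · have hYf := fin_of_not_big L (fun c => ∃ x, (x, c) ∈ R) hY
      have : Finite ↥{c | ∃ x, (x, c) ∈ R} := hYf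
      obtain ⟨⟨c, hc⟩, hcB⟩ := big_exFin L (ι := ↥{c | ∃ x, (x, c) ∈ R}) (fun c x => (x, c.1) ∈ R)
        (fun i => inferInstance)
        (hB1.mono (fun x ⟨c, hc⟩ => ⟨⟨c, x, hc⟩, hc⟩))
      obtain ⟨y, hy⟩ := lemQ L (fun x y => c < y ∧ ∀ z, c < z → z < y → (x, z) ∈ X) (by
        intro y y'
        by_cases h1 : c < y
        · by_cases h2 : c < y'
          · rcases le_total y y' with h | h
            · right; rintro x ⟨_, hx⟩; exact ⟨h1, fun z hz1 hz2 => hx z hz1 (hz2.trans_le h)⟩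
            · left; rintro x ⟨_, hx⟩; exact ⟨h2, fun z hz1 hz2 => hx z hz1 (hz2.trans_le h)⟩
          · right; rintro x ⟨h, _⟩; exact absurd h h2
        · left; rintro x ⟨h, _⟩; exact absurd h h1)
        (hcB.mono (fun x hx => ((hRi _ _).1 hx).1))
      have hcy : c < y := by
        obtain ⟨a, b, hab, h⟩ := hy
        obtain ⟨x, h1, h2⟩ := exbt hab
        exact (h x h1 h2).1
      exact ⟨c, y, hcy, fun z h1 h2 => hy.mono (fun x hx => hx.2 z h1 h2)⟩
  · obtain ⟨y, hy⟩ := lemQ L (fun x y => ∀ z, z < y → (x, z) ∈ X) (by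
        intro y y'
        rcases le_total y y' with h | h
        · right; intro x hx z hz; exact hx z (hz.trans_le h)
        · left; intro x hx z hz; exact hx z (hz.trans_le h)) hB2
    obtain ⟨y0, h0⟩ := exists_lt y
    exact ⟨y0, y, h0, fun z _ hz => hy.mono (fun x hx => hx z hz)⟩

theorem lemR' (ρ : M → M → Prop) [DefP L M (fun p : M × M => ρ p.1 p.2)] {a b : M} (hab : a < b)
    (h : ∀ x, a < x → x < b → ∃ z, z < x ∧ ∀ y, z < y → y < x → ρ x y) :
    ∃ p q, p < q ∧ ∀ x, p < x → x < q → a < x ∧ x < b ∧ ∀ y, p < y → y < x → ρ x y := by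
  obtain ⟨X, hX, rfl⟩ := exSet2 L M ρ
  obtain ⟨c, d, hcd, hB⟩ := fubini L (fun x y => a < x ∧ x < b ∧ y < x ∧
    ∀ y', y ≤ y' → y' < x → (x, y') ∈ X) (by
      refine ⟨a, b, hab, fun x h1 h2 => ?_⟩
      obtain ⟨z, hz, h3⟩ := h x h1 h2
      exact ⟨z, x, hz, fun y hy1 hy2 => ⟨h1, h2, hy2, fun y' h4 h5 => h3 y' (hy1.trans_le h4) h5⟩⟩)
  obtain ⟨y, hy1, hy2⟩ := exbt hcd
  obtain ⟨p, q, hpq, hB⟩ := hB y hy1 hy2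
  refine ⟨p, q, hpq, fun x h1 h2 => ?_⟩
  obtain ⟨h3, h4, h5, h6⟩ := hB x h1 h2
  refine ⟨h3, h4, fun y'' h7 h8 => h6 y'' ?_ h8⟩
  exact (hB y'' h7 (h8.trans h2)).2.2.1.le

end
end OM


open FirstOrder Set
set_option linter.unusedSectionVars false
set_option linter.unusedVariables false
set_option synthInstance.maxHeartbeats 400000
set_option synthInstance.maxSize 20000

namespace OM
universe u v w
section
variable (L : FirstOrder.Language.{v, w}) {M : Type u} [L.Structure M] [LinearOrder M] [OMin L M]
  [DenselyOrdered M] [NoMinOrder M] [NoMaxOrder M] [Nonempty M]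
  {α β γ : Type u} [Crd M α] [Crd M β] [Crd M γ]

/-- near `a` -/
def Ev (a : M) (P : M → Prop) : Prop := ∃ i j, i < a ∧ a < j ∧ ∀ x, i < x → x < j → P x

theorem Ev.mono {a : M} {P Q : M → Prop} (h : Ev a P) (hPQ : ∀ x, P x → Q x) : Ev a Q := by
  obtain ⟨i, j, h1, h2, h3⟩ := h
  exact ⟨i, j, h1, h2, fun x hx hx' => hPQ x (h3 x hx hx')⟩

theorem Ev.and {a : M} {P Q : M → Prop} (h : Ev a P) (h' : Ev a Q) : Ev a (fun x => P x ∧ Q x) := by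
  obtain ⟨i, j, h1, h2, h3⟩ := h
  obtain ⟨i', j', h1', h2', h3'⟩ := h'
  refine ⟨max i i', min j j', max_lt h1 h1', lt_min h2 h2', fun x hx hx' => ⟨?_, ?_⟩⟩
  · exact h3 x ((le_max_left _ _).trans_lt hx) (hx'.trans_le (min_le_left _ _))
  · exact h3' x ((le_max_right _ _).trans_lt hx) (hx'.trans_le (min_le_right _ _))

theorem Ev.self {a : M} {P : M → Prop} (h : Ev a P) : P a := by
  obtain ⟨i, j, h1, h2, h3⟩ := h
  exact h3 a h1 h2

theorem Ev.of_Ioo {a p q : M} {P : M → Prop} (h1 : p < a) (h2 : a < q)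
    (h : ∀ x, p < x → x < q → P x) : Ev a P := ⟨p, q, h1, h2, h⟩

theorem Ev.allFin {ι : Type*} {s : Set ι} (hs : s.Finite) {a : M} {P : ι → M → Prop}
    (h : ∀ i ∈ s, Ev a (P i)) : Ev a (fun x => ∀ i ∈ s, P i x) := by
  induction s, hs using Set.Finite.induction_on with
  | empty =>
    obtain ⟨i, hi⟩ := exists_lt a
    obtain ⟨j, hj⟩ := exists_gt a
    exact ⟨i, j, hi, hj, by simp⟩
  | insert _ _ ih =>
    have h1 := ih (fun i hi => h i (mem_insert_of_mem _ hi))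
    exact (h1.and (h _ (mem_insert _ _))).mono (fun x hx i hi => by
      rcases hi with rfl | hi
      · exact hx.2
      · exact hx.1 i hi)

instance DefP.ev {P : α → M → Prop} {f : α → M} [hf : DefF L M f]
    [hP : DefP L M (fun p : α × M => P p.1 p.2)] :
    DefP L M (fun a => Ev (f a) (fun z => P a z)) := by
  obtain ⟨X, hX, rfl⟩ := exSet2 L M P
  have : DefP L M (fun p : α × M => Ev p.2 (fun z => (p.1, z) ∈ X)) := by
    unfold Ev
    infer_instance
  exact this.comp (f := fun a => (a, f a)) inferInstance

def Ginf (X : M → M → Prop) (a : M) : Prop :=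
  ∃ u v, Ev a (fun x => ∀ y, X x y → u < y ∧ y < v)

def Gat (X : M → M → Prop) (a b : M) : Prop :=
  (¬ X a b ∧ ∃ u v, u < b ∧ b < v ∧ Ev a (fun x => ∀ y, u < y → y < v → ¬ X x y)) ∨
  (X a b ∧ (∃ u v, u < b ∧ b < v ∧
      Ev a (fun x => ∀ y y', u < y → y < v → u < y' → y' < v → X x y → X x y' → y = y')) ∧
    ∀ u v, u < b → b < v → Ev a (fun x => ∃ y, u < y ∧ y < v ∧ X x y))

def Good (X : M → M → Prop) (a : M) : Prop := Ginf X a ∧ ∀ b, Gat X a b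

section
variable (X : Set (M × M)) [hX : DefS L M X]

instance defGinf : DefP L M (fun a => Ginf (fun x y => (x, y) ∈ X) a) := by
  unfold Ginf; infer_instance

instance defGat : DefP L M (fun p : M × M => Gat (fun x y => (x, y) ∈ X) p.1 p.2) := by
  unfold Gat; beta_reduce; infer_instance
end

theorem defGood (X : Set (α × (M × M))) [hX : DefS L M X] :
    DefP L M (fun p : α × M => Good (fun x y => (p.1, (x, y)) ∈ X) p.2) := by
  unfold Good Ginf Gat; beta_reduce; infer_instance

theorem not_big_ginf (X : Set (M × M)) [hX : DefS L M X] (hfin : ∀ x, {y | (x, y) ∈ X}.Finite) :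
    ¬ Big (fun a => ¬ Ginf (fun x y => (x, y) ∈ X) a) := by
  rintro ⟨a, b, hab, h⟩
  obtain ⟨v, hv⟩ := lemQ L (fun x v => a < x ∧ x < b ∧ ∀ y, (x, y) ∈ X → y < v) (by
    intro y y'
    rcases le_total y y' with h | h
    · left; rintro x ⟨h1, h2, h3⟩; exact ⟨h1, h2, fun z hz => (h3 z hz).trans_le h⟩
    · right; rintro x ⟨h1, h2, h3⟩; exact ⟨h1, h2, fun z hz => (h3 z hz).trans_le h⟩)
    ⟨a, b, hab, fun x h1 h2 => by
      obtain ⟨m, hm⟩ := (hfin x).bddAbove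
      obtain ⟨v, hv⟩ := exists_gt m
      exact ⟨v, h1, h2, fun y hy => (hm hy).trans_lt hv⟩⟩
  obtain ⟨u, hu⟩ := lemQ L (fun x u => (a < x ∧ x < b ∧ ∀ y, (x, y) ∈ X → y < v) ∧
      ∀ y, (x, y) ∈ X → u < y) (by
    intro y y'
    rcases le_total y y' with h | h
    · right; rintro x ⟨h1, h2⟩; exact ⟨h1, fun z hz => h.trans_lt (h2 z hz)⟩
    · left; rintro x ⟨h1, h2⟩; exact ⟨h1, fun z hz => h.trans_lt (h2 z hz)⟩)
    (hv.mono fun x hx => by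
      obtain ⟨m, hm⟩ := (hfin x).bddBelow
      obtain ⟨v, hv⟩ := exists_lt m
      exact ⟨v, hx, fun y hy => hv.trans_le (hm hy)⟩)
  obtain ⟨p, q, hpq, h'⟩ := hu
  obtain ⟨c, hc1, hc2⟩ := exbt hpq
  obtain ⟨h1, h2⟩ := h' c hc1 hc2
  refine h c h1.1 h1.2.1 ⟨u, v, Ev.of_Ioo hc1 hc2 fun x hx1 hx2 y hy => ?_⟩
  exact ⟨(h' x hx1 hx2).2 y hy, (h' x hx1 hx2).1.2.2 y hy⟩

theorem not_big_gat (X : Set (M × M)) [hX : DefS L M X] (hfin : ∀ x, {y | (x, y) ∈ X}.Finite)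
    (b : M) : ¬ Big (fun a => ¬ Gat (fun x y => (x, y) ∈ X) a b) := by
  intro hB
  have hd : DefP L M (fun a => Gat (fun x y => (x, y) ∈ X) a b) :=
    (defGat L X).comp (f := fun a => (a, b)) inferInstance
  have key : ∀ P : Set M, DefS L M P → Big (fun x => x ∈ P) → ∃ p q u v, p < q ∧ u < b ∧ b < v ∧
      ∀ x, p < x → x < q → x ∈ P ∧ ∀ y, u < y → y < v → (x, y) ∈ X → y = b := by
    intro P hP hB
    obtain ⟨v, hv⟩ := lemQ L (fun x v => x ∈ P ∧ b < v ∧ ∀ y, b < y → y < v → (x, y) ∉ X) (by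
      intro y y'
      by_cases h1 : b < y
      · by_cases h2 : b < y'
        · rcases le_total y y' with h | h
          · right; rintro x ⟨hP, _, hx⟩; exact ⟨hP, h1, fun z hz1 hz2 => hx z hz1 (hz2.trans_le h)⟩
          · left; rintro x ⟨hP, _, hx⟩; exact ⟨hP, h2, fun z hz1 hz2 => hx z hz1 (hz2.trans_le h)⟩
        · right; rintro x ⟨_, h, _⟩; exact absurd h h2
      · left; rintro x ⟨_, h, _⟩; exact absurd h h1) (hB.mono fun x hx => by
        obtain ⟨b', hb'⟩ := exists_gt b
        obtain ⟨c, h1, h2, h3⟩ := fin_below (P := fun y => b < y ∧ (x, y) ∈ X)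
          ((hfin x).subset fun y hy => hy.2) hb' (fun y hy => hy.1)
        exact ⟨c, hx, h1, fun y hy1 hy2 hy3 => hy2.asymm (h3 y ⟨hy1, hy3⟩)⟩)
    obtain ⟨u, p, q, hpq, h⟩ := lemQ L (fun x v' => v' < b ∧
        (x ∈ P ∧ b < v ∧ ∀ y, b < y → y < v → (x, y) ∉ X) ∧
        ∀ y, v' < y → y < b → (x, y) ∉ X) (by
      intro y y'
      by_cases h1 : y < b
      · by_cases h2 : y' < b
        · rcases le_total y y' with h | h
          · left; rintro x ⟨_, hP, hx⟩; exact ⟨h2, hP, fun z hz1 hz2 => hx z (h.trans_lt hz1) hz2⟩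
          · right; rintro x ⟨_, hP, hx⟩; exact ⟨h1, hP, fun z hz1 hz2 => hx z (h.trans_lt hz1) hz2⟩
        · right; rintro x ⟨h, _⟩; exact absurd h h2
      · left; rintro x ⟨h, _⟩; exact absurd h h1) (hv.mono fun x hx => by
        obtain ⟨b', hb'⟩ := exists_lt b
        obtain ⟨c, h1, h2, h3⟩ := fin_above (P := fun y => y < b ∧ (x, y) ∈ X)
          ((hfin x).subset fun y hy => hy.2) hb' (fun y hy => hy.1)
        exact ⟨c, h2, hx, fun y hy1 hy2 hy3 => hy1.asymm (h3 y ⟨hy2, hy3⟩)⟩)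
    obtain ⟨c, hc1, hc2⟩ := exbt hpq
    refine ⟨p, q, u, v, hpq, (h c hc1 hc2).1, (h c hc1 hc2).2.1.2.1, fun x hx1 hx2 =>
      ⟨(h x hx1 hx2).2.1.1, fun y hy1 hy2 hy3 => ?_⟩⟩
    rcases lt_trichotomy y b with h' | h' | h'
    · exact absurd hy3 ((h x hx1 hx2).2.2 y hy1 h')
    · exact h'
    · exact absurd hy3 ((h x hx1 hx2).2.1.2.2 y h' hy2)
  rcases Big.split L _ (fun x => (x, b) ∈ X) hB with hB | hB
  · obtain ⟨p, q, u, v, hpq, hu, hv, h⟩ := key {x | ¬ Gat (fun x y => (x, y) ∈ X) x b ∧ (x, b) ∈ X}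
      inferInstance hB
    obtain ⟨c, hc1, hc2⟩ := exbt hpq
    refine (h c hc1 hc2).1.1 (Or.inr ⟨(h c hc1 hc2).1.2, ⟨u, v, hu, hv, ?_⟩, ?_⟩)
    · refine Ev.of_Ioo hc1 hc2 fun x h1 h2 y y' h3 h4 h5 h6 h7 h8 => ?_
      rw [(h x h1 h2).2 y h3 h4 h7, (h x h1 h2).2 y' h5 h6 h8]
    · intro u' v' hu' hv'
      exact Ev.of_Ioo hc1 hc2 fun x h1 h2 => ⟨b, hu', hv', (h x h1 h2).1.2⟩
  · obtain ⟨p, q, u, v, hpq, hu, hv, h⟩ := key {x | ¬ Gat (fun x y => (x, y) ∈ X) x b ∧ (x, b) ∉ X}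
      inferInstance hB
    obtain ⟨c, hc1, hc2⟩ := exbt hpq
    refine (h c hc1 hc2).1.1 (Or.inl ⟨(h c hc1 hc2).1.2, u, v, hu, hv, ?_⟩)
    refine Ev.of_Ioo hc1 hc2 fun x h1 h2 y h3 h4 h5 => (h x h1 h2).1.2 ?_
    rw [← (h x h1 h2).2 y h3 h4 h5]; exact h5

/-- a definable function that is everywhere locally jumping cannot exist (up version) -/
theorem no_jump (B : Set (M × M)) [DefS L M B] (hfun : ∀ a b b', (a, b) ∈ B → (a, b') ∈ B → b = b') :
    ¬ Big (fun a => ∃ y b, (a, b) ∈ B ∧ b < y ∧ ∀ i j, i < a → a < j →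
      ∃ x, i < x ∧ x < j ∧ ∃ b', (x, b') ∈ B ∧ y ≤ b') := by
  intro hB
  obtain ⟨c, d, hcd, h⟩ := fubini L (fun a y => ∃ b, (a, b) ∈ B ∧ b < y ∧ ∀ i j, i < a → a < j →
      ∃ x, i < x ∧ x < j ∧ ∃ b', (x, b') ∈ B ∧ y ≤ b') (hB.mono (by
        rintro a ⟨y, b, hb, hby, h⟩
        refine ⟨b, y, hby, fun y' h1 h2 => ⟨b, hb, h1, fun i j hi hj => ?_⟩⟩
        obtain ⟨x, h3, h4, b', h5, h6⟩ := h i j hi hj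
        exact ⟨x, h3, h4, b', h5, h2.le.trans h6⟩))
  obtain ⟨y, hy1, hy2⟩ := exbt hcd
  obtain ⟨p, q, hpq, h⟩ := h y hy1 hy2
  obtain ⟨a, ha1, ha2⟩ := exbt hpq
  obtain ⟨b, hb, hby, h'⟩ := h a ha1 ha2
  obtain ⟨x, h3, h4, b', h5, h6⟩ := h' p q ha1 ha2
  obtain ⟨b'', h7, h8, _⟩ := h x h3 h4
  rw [hfun _ _ _ h5 h7] at h6
  exact absurd h6 (not_le.2 h8)

theorem no_jump' (B : Set (M × M)) [DefS L M B] (hfun : ∀ a b b', (a, b) ∈ B → (a, b') ∈ B → b = b') :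
    ¬ Big (fun a => ∃ y b, (a, b) ∈ B ∧ y < b ∧ ∀ i j, i < a → a < j →
      ∃ x, i < x ∧ x < j ∧ ∃ b', (x, b') ∈ B ∧ b' ≤ y) := by
  intro hB
  obtain ⟨c, d, hcd, h⟩ := fubini L (fun a y => ∃ b, (a, b) ∈ B ∧ y < b ∧ ∀ i j, i < a → a < j →
      ∃ x, i < x ∧ x < j ∧ ∃ b', (x, b') ∈ B ∧ b' ≤ y) (hB.mono (by
        rintro a ⟨y, b, hb, hby, h⟩
        refine ⟨y, b, hby, fun y' h1 h2 => ⟨b, hb, h2, fun i j hi hj => ?_⟩⟩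
        obtain ⟨x, h3, h4, b', h5, h6⟩ := h i j hi hj
        exact ⟨x, h3, h4, b', h5, h6.trans h1.le⟩))
  obtain ⟨y, hy1, hy2⟩ := exbt hcd
  obtain ⟨p, q, hpq, h⟩ := h y hy1 hy2
  obtain ⟨a, ha1, ha2⟩ := exbt hpq
  obtain ⟨b, hb, hby, h'⟩ := h a ha1 ha2
  obtain ⟨x, h3, h4, b', h5, h6⟩ := h' p q ha1 ha2
  obtain ⟨b'', h7, h8, _⟩ := h x h3 h4
  rw [hfun _ _ _ h5 h7] at h6
  exact absurd h6 (not_le.2 h8)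

theorem not_big_gat' (X : Set (M × M)) [hX : DefS L M X] (hfin : ∀ x, {y | (x, y) ∈ X}.Finite) :
    ¬ Big (fun a => ∃ b, ¬ Gat (fun x y => (x, y) ∈ X) a b) := by
  intro hB
  obtain ⟨N, hN⟩ : ∃ N : Set (M × M), N = {p | ¬ Gat (fun x y => (x, y) ∈ X) p.1 p.2} := ⟨_, rfl⟩
  have hNd : DefS L M N := by rw [hN]; infer_instance
  have hNi : ∀ a b, (a, b) ∈ N ↔ ¬ Gat (fun x y => (x, y) ∈ X) a b := by
    intro a b; rw [hN]; rfl
  have hii : ∀ b, ¬ Big (fun a => (a, b) ∈ N) := by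
    intro b; simp only [hNi]; exact not_big_gat L X hfin b
  simp only [← hNi] at hB
  -- fibres of N are mostly finite
  have hNB : ¬ Big (fun a => Big (fun b => (a, b) ∈ N)) := by
    intro h
    obtain ⟨p, q, hpq, h⟩ := fubini L (fun a b => (a, b) ∈ N) h
    obtain ⟨c, h1, h2⟩ := exbt hpq
    exact hii c (h c h1 h2)
  obtain ⟨B, hBd, hBi⟩ : ∃ B : Set (M × M), DefS L M B ∧
      ∀ a b, (a, b) ∈ B ↔ (a, b) ∈ N ∧ ∀ b', (a, b') ∈ N → b ≤ b' :=
    ⟨{p | p ∈ N ∧ ∀ b', (p.1, b') ∈ N → p.2 ≤ b'}, inferInstance, fun a b => Iff.rfl⟩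
  have hfun : ∀ a b b', (a, b) ∈ B → (a, b') ∈ B → b = b' := by
    intro a b b' h1 h2
    rw [hBi] at h1 h2
    exact le_antisymm (h1.2 _ h2.1) (h2.2 _ h1.1)
  have hBdom : Big (fun a => ∃ b, (a, b) ∈ B) := by
    have := (Big.split L _ (fun a => Big (fun b => (a, b) ∈ N)) hB).resolve_left
      (fun h => hNB (h.mono fun x hx => hx.2))
    refine this.mono ?_
    rintro a ⟨hne, hnb⟩
    obtain ⟨m, hm, hm'⟩ := fin_min (fin_of_not_big L (fun b => (a, b) ∈ N) hnb) hne
    exact ⟨m, (hBi _ _).2 ⟨hm, hm'⟩⟩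
  have hBfin : ∀ b, {a | (a, b) ∈ B}.Finite := by
    intro b
    apply fin_of_not_big L (fun a => (a, b) ∈ B)
    exact fun h => hii b (h.mono fun a ha => ((hBi _ _).1 ha).1)
  have hY : Big (fun b => ∃ a, (a, b) ∈ B) := by
    by_contra hY
    have hYf := fin_of_not_big L _ hY
    refine hBdom.inf ((hYf.biUnion (fun b _ => hBfin b)).subset ?_)
    rintro a ⟨b, hb⟩
    exact mem_biUnion (⟨a, hb⟩ : ∃ a, (a, b) ∈ B) hb
  obtain ⟨r, s, hrs, hY⟩ := hY
  have hUfin : ∀ b, {y | ∃ a, (a, b) ∈ B ∧ (a, y) ∈ X}.Finite := by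
    intro b
    refine ((hBfin b).biUnion (fun a _ => hfin a)).subset ?_
    rintro y ⟨a, h1, h2⟩
    exact mem_biUnion h1 h2
  obtain ⟨r1, s1, hrs1, h1⟩ := lemR L (fun b y => ∀ a, (a, b) ∈ B → (a, y) ∉ X) hrs (by
    intro b _ _
    obtain ⟨b', hb'⟩ := exists_gt b
    obtain ⟨c, h1, h2, h3⟩ := fin_below (P := fun y => b < y ∧ ∃ a, (a, b) ∈ B ∧ (a, y) ∈ X)
      ((hUfin b).subset fun y hy => hy.2) hb' (fun y hy => hy.1)
    exact ⟨c, h1, fun y hy1 hy2 a ha hay => hy2.asymm (h3 y ⟨hy1, a, ha, hay⟩)⟩)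
  obtain ⟨r2, s2, hrs2, h2⟩ := lemR' L (fun b y => ∀ a, (a, b) ∈ B → (a, y) ∉ X) hrs1 (by
    intro b _ _
    obtain ⟨b', hb'⟩ := exists_lt b
    obtain ⟨c, h1, h2, h3⟩ := fin_above (P := fun y => y < b ∧ ∃ a, (a, b) ∈ B ∧ (a, y) ∈ X)
      ((hUfin b).subset fun y hy => hy.2) hb' (fun y hy => hy.1)
    exact ⟨c, h2, fun y hy1 hy2 a ha hay => hy1.asymm (h3 y ⟨hy2, a, ha, hay⟩)⟩)
  have huniq : ∀ a b y, r2 < b → b < s2 → r2 < y → y < s2 → (a, b) ∈ B → (a, y) ∈ X → y = b := by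
    intro a b y hb1 hb2 hy1 hy2 hab hay
    rcases lt_trichotomy y b with h | h | h
    · exact absurd hay ((h2 b hb1 hb2).2.2 y hy1 h a hab)
    · exact h
    · have hb := h2 b hb1 hb2
      have hy := h2 y hy1 hy2
      exact absurd hay ((h1 b hb.1 hb.2.1).2.2 y h hy.2.1 a hab)
  have hBig : Big (fun a => ∃ b, r2 < b ∧ b < s2 ∧ (a, b) ∈ B) := by
    apply big_of_inf L
    intro hf
    have h3 : {b | r2 < b ∧ b < s2}.Finite := by
      refine (hf.biUnion (t := fun a => {b | (a, b) ∈ B}) (fun a _ => ?_)).subset ?_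
      · apply Set.Subsingleton.finite
        intro b hb b' hb'
        exact hfun a b b' hb hb'
      · rintro b ⟨hb1, hb2⟩
        have h3 := h2 b hb1 hb2
        have h4 := h1 b h3.1 h3.2.1
        obtain ⟨a, ha⟩ := hY b h4.1 h4.2.1
        exact mem_biUnion (⟨b, hb1, hb2, ha⟩ : ∃ b, r2 < b ∧ b < s2 ∧ (a, b) ∈ B) ha
    exact Set.Ioo_infinite hrs2 h3
  have hBig2 := Big.or L (P := fun a => ∃ b, r2 < b ∧ b < s2 ∧ (a, b) ∈ B ∧ (a, b) ∈ X)
    (Q := fun a => ∃ b, r2 < b ∧ b < s2 ∧ (a, b) ∈ B ∧ (a, b) ∉ X) (hBig.mono (by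
      rintro a ⟨b, h1, h2, h3⟩
      by_cases h : (a, b) ∈ X
      · exact Or.inl ⟨b, h1, h2, h3, h⟩
      · exact Or.inr ⟨b, h1, h2, h3, h⟩))
  rcases hBig2 with ⟨p, q, hpq, h⟩ | ⟨p, q, hpq, h⟩
  · -- always
    have hJ : ∀ a, p < a → a < q →
        (∃ y b, (a, b) ∈ B ∧ b < y ∧ ∀ i j, i < a → a < j →
          ∃ x, i < x ∧ x < j ∧ ∃ b', (x, b') ∈ B ∧ y ≤ b') ∨
        (∃ y b, (a, b) ∈ B ∧ y < b ∧ ∀ i j, i < a → a < j →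
          ∃ x, i < x ∧ x < j ∧ ∃ b', (x, b') ∈ B ∧ b' ≤ y) := by
      intro a ha1 ha2
      by_contra! hcon
      obtain ⟨hU, hD⟩ := hcon
      obtain ⟨b, hb1, hb2, hab, hX⟩ := h a ha1 ha2
      refine (hNi _ _).1 ((hBi _ _).1 hab).1 (Or.inr ⟨hX, ⟨r2, s2, hb1, hb2, ?_⟩, ?_⟩)
      · refine Ev.of_Ioo ha1 ha2 fun x hx1 hx2 y y' h3 h4 h5 h6 h7 h8 => ?_
        obtain ⟨b', hb1', hb2', hab', hX'⟩ := h x hx1 hx2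
        rw [huniq x b' y hb1' hb2' h3 h4 hab' h7, huniq x b' y' hb1' hb2' h5 h6 hab' h8]
      · intro u v hu hv
        obtain ⟨i, j, hi, hj, hU⟩ := hU v b hab hv
        obtain ⟨i', j', hi', hj', hD⟩ := hD u b hab hu
        refine ((Ev.of_Ioo ha1 ha2 h).and ((Ev.of_Ioo hi hj hU).and (Ev.of_Ioo hi' hj' hD))).mono ?_
        rintro x ⟨⟨b', h3, h4, h5, h6⟩, h7, h8⟩
        exact ⟨b', h8 b' h5, h7 b' h5, h6⟩
    rcases Big.or L ⟨p, q, hpq, hJ⟩ with h | h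
    · exact no_jump L B hfun h
    · exact no_jump' L B hfun h
  · obtain ⟨a, ha1, ha2⟩ := exbt hpq
    obtain ⟨b, hb1, hb2, hab, hX⟩ := h a ha1 ha2
    refine (hNi _ _).1 ((hBi _ _).1 hab).1 (Or.inl ⟨hX, r2, s2, hb1, hb2, ?_⟩)
    refine Ev.of_Ioo ha1 ha2 fun x hx1 hx2 y hy1 hy2 hy => ?_
    obtain ⟨b', hb1', hb2', hab', hX'⟩ := h x hx1 hx2
    rw [huniq x b' y hb1' hb2' hy1 hy2 hab' hy] at hy
    exact hX' hy

theorem not_big_not_good (X : M → M → Prop) [hX : DefP L M (fun p : M × M => X p.1 p.2)]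
    (hfin : ∀ x, {y | X x y}.Finite) : ¬ Big (fun a => ¬ Good X a) := by
  obtain ⟨X, hX, rfl⟩ := exSet2 L M X
  intro hB
  have h1 := Big.or L (P := fun a => ¬ Ginf (fun x y => (x, y) ∈ X) a)
    (Q := fun a => ∃ b, ¬ Gat (fun x y => (x, y) ∈ X) a b) (hB.mono (fun a ha => by
      unfold Good at ha
      rw [not_and_or, not_forall] at ha
      exact ha))
  rcases h1 with h1 | h1
  · exact not_big_ginf L X hfin h1
  · exact not_big_gat' L X hfin h1

end
end OM


open FirstOrder Set
set_option linter.unusedSectionVars false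
set_option linter.unusedVariables false
set_option synthInstance.maxHeartbeats 400000
set_option synthInstance.maxSize 20000

namespace OM
universe u v w
section
variable (L : FirstOrder.Language.{v, w}) {M : Type u} [L.Structure M] [LinearOrder M] [OMin L M]
  [DenselyOrdered M] [NoMinOrder M] [NoMaxOrder M] [Nonempty M]
  {α β γ : Type u} [Crd M α] [Crd M β] [Crd M γ]

theorem heine (X : Set (M × M)) [hX : DefS L M X] (a : M)
    (hG : Good (fun x y => (x, y) ∈ X) a) (U : Set M) [hU : DefS L M U]
    (hopen : ∀ y ∈ U, ∃ u v, u < y ∧ y < v ∧ ∀ z, u < z → z < v → z ∈ U)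
    (hS : ∀ y, (a, y) ∈ X → y ∈ U) : Ev a (fun x => ∀ y, (x, y) ∈ X → y ∈ U) := by
  obtain ⟨⟨u, v, huv⟩, hG⟩ := hG
  have hloc : ∀ s, ∃ u' v', u' < s ∧ s < v' ∧
      Ev a (fun x => ∀ y, u' < y → y < v' → (x, y) ∈ X → y ∈ U) := by
    intro s
    rcases hG s with ⟨h1, u', v', h2, h3, h4⟩ | ⟨h1, -, -⟩
    · exact ⟨u', v', h2, h3, h4.mono fun x hx y hy1 hy2 hy => absurd hy (hx y hy1 hy2)⟩
    · obtain ⟨u', v', h2, h3, h4⟩ := hopen s (hS s h1)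
      exact ⟨u', v', h2, h3, huv.mono fun x hx y hy1 hy2 hy => h4 y hy1 hy2⟩
  have hv : Ev a (fun x => ∀ y, y ≤ v → (x, y) ∈ X → y ∈ U) := by
    by_contra hcon
    obtain ⟨s, hs⟩ := ex_lub L (fun t => t ≤ v ∧ Ev a (fun x => ∀ y, y ≤ t → (x, y) ∈ X → y ∈ U))
      ⟨min u v, min_le_right _ _, huv.mono fun x hx y hy hxy =>
        absurd (hx y hxy).1 (not_lt.2 (hy.trans (min_le_left _ _)))⟩ ⟨v, fun x hx => hx.1⟩
    have hsv : s ≤ v := hs.2 fun x hx => hx.1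
    obtain ⟨u', v', h1, h2, h3⟩ := hloc s
    obtain ⟨t, ht, htu, hts⟩ := hs.exists_between h1
    have hup : ∀ t', t' < v' → Ev a (fun x => ∀ y, y ≤ t' → (x, y) ∈ X → y ∈ U) := by
      intro t' ht'
      refine (ht.2.and h3).mono ?_
      rintro x ⟨hx1, hx2⟩ y hy hxy
      rcases le_or_gt y t with h | h
      · exact hx1 y h hxy
      · exact hx2 y (htu.trans h) (hy.trans_lt ht') hxy
    rcases hsv.eq_or_lt with h | h
    · exact hcon (hup v (h ▸ h2))
    · obtain ⟨t', h4, h5⟩ := exbt (lt_min h h2)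
      have : t' ≤ s := hs.1 ⟨(h5.trans_le (min_le_left _ _)).le, hup t' (h5.trans_le (min_le_right _ _))⟩
      exact absurd h4 (not_lt.2 this)
  exact (huv.and hv).mono fun x hx y hy => hx.2 y (hx.1 y hy).2.le hy

theorem good_ncard (X : M → M → Prop) [hX : DefP L M (fun p : M × M => X p.1 p.2)]
    (hfin : ∀ x, {y | X x y}.Finite) (a : M) (hG : Good X a) :
    Ev a (fun x => {y | X x y}.ncard = {y | X a y}.ncard) := by
  obtain ⟨X, hX, rfl⟩ := exSet2 L M X
  set S : Set M := {y | (a, y) ∈ X} with hSdef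
  have hS : S.Finite := hfin a
  have hm : ∀ b b' : M, ∃ m, b < b' → b < m ∧ m < b' := by
    intro b b'
    by_cases h : b < b'
    · obtain ⟨m, h1, h2⟩ := exbt h
      exact ⟨m, fun _ => ⟨h1, h2⟩⟩
    · exact ⟨b, fun h' => absurd h' h⟩
  choose m hm using hm
  have hJ : ∀ b, b ∈ S → ∃ u v, u < b ∧ b < v ∧ (∀ b' ∈ S, b < b' → v < m b b') ∧
      (∀ b' ∈ S, b' < b → m b' b < u) ∧
      Ev a (fun x => ∀ y y', u < y → y < v → u < y' → y' < v → (x, y) ∈ X → (x, y') ∈ X → y = y') ∧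
      Ev a (fun x => ∃ y, u < y ∧ y < v ∧ (x, y) ∈ X) := by
    intro b hb
    rcases hG.2 b with ⟨h1, -⟩ | ⟨h1, ⟨u0, v0, hu0, hv0, h2⟩, h3⟩
    · exact absurd hb h1
    · obtain ⟨v, hv1, hv2, hv3⟩ := fin_below (P := fun y => ∃ b', b' ∈ S ∧ b < b' ∧ y = m b b')
        ((hS.image (fun b' => m b b')).subset (by
          rintro y ⟨b', h1, h2, rfl⟩; exact ⟨b', h1, rfl⟩)) hv0
        (by rintro y ⟨b', h1, h2, rfl⟩; exact (hm b b' h2).1)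
      obtain ⟨u, hu1, hu2, hu3⟩ := fin_above (P := fun y => ∃ b', b' ∈ S ∧ b' < b ∧ y = m b' b)
        ((hS.image (fun b' => m b' b)).subset (by
          rintro y ⟨b', h1, h2, rfl⟩; exact ⟨b', h1, rfl⟩)) hu0
        (by rintro y ⟨b', h1, h2, rfl⟩; exact (hm b' b h2).2)
      refine ⟨u, v, hu2, hv1, fun b' hb' h => hv3 _ ⟨b', hb', h, rfl⟩,
        fun b' hb' h => hu3 _ ⟨b', hb', h, rfl⟩, ?_, h3 u v hu2 hv1⟩
      exact h2.mono fun x hx y y' h4 h5 h6 h7 => hx y y' (hu1.trans h4) (h5.trans hv2)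
        (hu1.trans h6) (h7.trans hv2)
  choose! u v hu hv hvm hmu hE1 hE2 using hJ
  have hSf : Finite ↥S := hS
  have hUd : DefS L M {y | ∃ b : ↥S, u b < y ∧ y < v b} := ⟨DefP.exFin (fun b => inferInstance)⟩
  have hB := heine L X a hG {y | ∃ b : ↥S, u b < y ∧ y < v b} (by
    rintro y ⟨b, h1, h2⟩
    exact ⟨u b, v b, h1, h2, fun z h3 h4 => ⟨b, h3, h4⟩⟩)
    (fun y hy => ⟨⟨y, hy⟩, hu y hy, hv y hy⟩)
  refine (hB.and ((Ev.allFin hS hE1).and (Ev.allFin hS hE2))).mono ?_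
  rintro x ⟨h1, h2, h3⟩
  apply le_antisymm
  · have h1' : ∀ y, (x, y) ∈ X → ∃ b, b ∈ S ∧ u b < y ∧ y < v b := by
      intro y hy
      obtain ⟨b, hb⟩ := h1 y hy
      exact ⟨b, b.2, hb⟩
    choose! f hf using h1'
    refine Set.ncard_le_ncard_of_injOn f (fun y hy => (hf y hy).1) ?_ hS
    intro y hy y' hy' hh
    have e1 := (hf y hy).2
    have e2 := (hf y' hy').2
    rw [← hh] at e2
    exact h2 (f y) (hf y hy).1 y y' e1.1 e1.2 e2.1 e2.2 hy hy'
  · choose! g hg using h3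
    refine Set.ncard_le_ncard_of_injOn g (fun b hb => (hg b hb).2.2) ?_ (hfin x)
    have hlt : ∀ b b', b ∈ S → b' ∈ S → b < b' → g b < g b' := by
      intro b b' hb hb' h
      exact ((hg b hb).2.1.trans (hvm b hb b' hb' h)).trans ((hmu b' hb' b hb h).trans (hg b' hb').1)
    intro b hb b' hb' heq
    rcases lt_trichotomy b b' with h | h | h
    · exact absurd heq (hlt b b' hb hb' h).ne
    · exact h
    · exact absurd heq (hlt b' b hb' hb h).ne'

theorem def_ncard_ge (k : ℕ) : ∀ {α : Type u} [Crd M α] (X : Set (α × M)) [DefS L M X],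
    (∀ a, {y | (a, y) ∈ X}.Finite) → DefP L M (fun a => k ≤ {y | (a, y) ∈ X}.ncard) := by
  induction k with
  | zero => intro α _ X _ _; simp only [Nat.zero_le]; infer_instance
  | succ k ih =>
    intro α _ X _ hf
    have h := ih (α := α × M) {p | (p.1.1, p.2) ∈ X ∧ p.1.2 < p.2}
      (fun a => (hf a.1).subset fun y hy => hy.1)
    have h' : DefP L M (fun a => ∃ y, (a, y) ∈ X ∧
        k ≤ {z | ((a, y), z) ∈ {p : (α × M) × M | (p.1.1, p.2) ∈ X ∧ p.1.2 < p.2}}.ncard) := by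
      obtain ⟨Y, hY, hYe⟩ := exSet L M (fun a : α × M =>
        k ≤ {z | (a, z) ∈ {p : (α × M) × M | (p.1.1, p.2) ∈ X ∧ p.1.2 < p.2}}.ncard)
      have hYe' : ∀ a, (k ≤ {z | (a, z) ∈ {p : (α × M) × M | (p.1.1, p.2) ∈ X ∧ p.1.2 < p.2}}.ncard) ↔
        a ∈ Y := fun a => by rw [congrFun hYe a]
      simp only [hYe']
      infer_instance
    refine h'.congr fun a => ?_
    constructor
    · intro hk
      have hne : {y | (a, y) ∈ X}.Nonempty := by
        rw [← Set.ncard_pos (hf a)]; omega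
      obtain ⟨m, hm, hm'⟩ := fin_min (hf a) hne
      refine ⟨m, hm, ?_⟩
      have : {y | (a, y) ∈ X} ⊆ insert m {z | (a, z) ∈ X ∧ m < z} := by
        intro z hz
        rcases (hm' z hz).eq_or_lt with h | h
        · exact Or.inl h.symm
        · exact Or.inr ⟨hz, h⟩
      have h2 := Set.ncard_le_ncard this (((hf a).subset fun y hy => hy.1).insert m)
      have h3 := Set.ncard_insert_le m {z | (a, z) ∈ X ∧ m < z}
      change k ≤ {z | (a, z) ∈ X ∧ m < z}.ncard
      omega
    · rintro ⟨m, hm, hk⟩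
      change k ≤ {z | (a, z) ∈ X ∧ m < z}.ncard at hk
      have hfm : {z | (a, z) ∈ X ∧ m < z}.Finite := (hf a).subset fun y hy => hy.1
      have h3 := Set.ncard_insert_of_notMem (a := m) (s := {z | (a, z) ∈ X ∧ m < z})
        (fun h => lt_irrefl _ h.2) hfm
      have : insert m {z | (a, z) ∈ X ∧ m < z} ⊆ {y | (a, y) ∈ X} := by
        rintro z (rfl | hz)
        · exact hm
        · exact hz.1
      have h2 := Set.ncard_le_ncard this (hf a)
      omega

theorem def_ncard_eq (k : ℕ) (X : Set (α × M)) [DefS L M X]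
    (hf : ∀ a, {y | (a, y) ∈ X}.Finite) : DefP L M (fun a => {y | (a, y) ∈ X}.ncard = k) := by
  have h1 := def_ncard_ge L k X hf
  have h2 := def_ncard_ge L (k + 1) X hf
  refine (inferInstance : DefP L M (fun a => k ≤ {y | (a, y) ∈ X}.ncard ∧
    ¬ (k + 1 ≤ {y | (a, y) ∈ X}.ncard))).congr fun a => ?_
  omega

/-- the `i`-th graph -/
def Gr (X : Set (α × M)) (i : ℕ) : Set (α × M) :=
  {p | p ∈ X ∧ {z | (p.1, z) ∈ X ∧ z < p.2}.ncard = i}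

theorem def_Gr (X : Set (α × M)) [DefS L M X] (hf : ∀ a, {y | (a, y) ∈ X}.Finite) (i : ℕ) :
    DefS L M (Gr X i) := by
  have h := def_ncard_eq L i (α := α × M) {p | (p.1.1, p.2) ∈ X ∧ p.2 < p.1.2}
      (fun a => (hf a.1).subset fun y hy => hy.1)
  have h2 : DefP L M (fun p : α × M => {z | (p.1, z) ∈ X ∧ z < p.2}.ncard = i) := h
  unfold Gr
  infer_instance

theorem Gr_fun (X : Set (α × M)) (hf : ∀ a, {y | (a, y) ∈ X}.Finite) (i : ℕ) (a : α) (y y' : M)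
    (h : (a, y) ∈ Gr X i) (h' : (a, y') ∈ Gr X i) : y = y' := by
  have key : ∀ y y', (a, y) ∈ Gr X i → (a, y') ∈ Gr X i → ¬ y < y' := by
    rintro y y' ⟨h1, h2⟩ ⟨h3, h4⟩ hlt
    have hs : insert y {z | (a, z) ∈ X ∧ z < y} ⊆ {z | (a, z) ∈ X ∧ z < y'} := by
      rintro z (rfl | hz)
      · exact ⟨h1, hlt⟩
      · exact ⟨hz.1, hz.2.trans hlt⟩
    have h5 := Set.ncard_le_ncard hs ((hf a).subset fun y hy => hy.1)
    rw [Set.ncard_insert_of_notMem (fun h => lt_irrefl _ h.2) ((hf a).subset fun y hy => hy.1)] at h5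
    simp only at h2 h4
    omega
  exact le_antisymm (not_lt.1 (key _ _ h' h)) (not_lt.1 (key _ _ h h'))

theorem Gr_ex (X : Set (α × M)) (hf : ∀ a, {y | (a, y) ∈ X}.Finite) (K : ℕ)
    (hK : ∀ a, {y | (a, y) ∈ X}.ncard ≤ K) (a : α) (y : M) (h : (a, y) ∈ X) :
    ∃ i, i < K ∧ (a, y) ∈ Gr X i := by
  refine ⟨_, ?_, h, rfl⟩
  refine lt_of_lt_of_le ?_ (hK a)
  apply Set.ncard_lt_ncard _ (hf a)
  refine ⟨fun z hz => hz.1, fun hh => ?_⟩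
  exact lt_irrefl _ (hh h).2

theorem loc_const (f : M → ℕ) (hd : ∀ k, DefP L M (fun x => f x = k)) {s1 s2 : M} (h12 : s1 ≤ s2)
    (h : ∀ s, s1 ≤ s → s ≤ s2 → Ev s (fun x => f x = f s)) : f s1 = f s2 := by
  rcases h12.eq_or_lt with rfl | hlt
  · rfl
  by_contra hne
  have := hd (f s1)
  obtain ⟨s, h1, h2, h3⟩ := bd_between L (fun x => f x = f s1) hlt ⟨rfl, fun h => hne h.symm⟩
  obtain ⟨i, j, hi, hj, hE⟩ := h s h1 h2
  obtain ⟨⟨x, hx1, hx2, hx3⟩, ⟨y, hy1, hy2, hy3⟩⟩ := h3 i j hi hj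
  beta_reduce at hx3 hy3
  rw [hE x hx1 hx2] at hx3
  rw [hE y hy1 hy2] at hy3
  exact hy3 hx3

end
end OM


open FirstOrder Set
set_option linter.unusedSectionVars false
set_option linter.unusedVariables false
set_option synthInstance.maxHeartbeats 400000
set_option synthInstance.maxSize 20000

namespace OM
universe u v w
section
variable (L : FirstOrder.Language.{v, w}) {M : Type u} [L.Structure M] [LinearOrder M] [OMin L M]
  [DenselyOrdered M] [NoMinOrder M] [NoMaxOrder M] [Nonempty M]
  {α β γ : Type u} [Crd M α] [Crd M β] [Crd M γ]


structure ThickOn (γ : Type u) [Crd M γ] (T : (γ → Prop) → Prop) : Prop where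
  mono : ∀ P Q : γ → Prop, T P → (∀ y, P y → Q y) → T Q
  ne : ∀ P, T P → ∃ y, P y
  of : ∀ P Q : γ → Prop, DefP L M P → DefP L M Q → T (fun y => P y ∨ Q y) → T P ∨ T Q
  dfn : ∀ (δ : Type u) [Crd M δ] (A : Set (δ × γ)), DefS L M A → DefP L M (fun a => T (fun y => (a, y) ∈ A))
  flip : ∀ A : Set (M × γ), DefS L M A → Big (fun s => T (fun y => (s, y) ∈ A)) →
    T (fun y => Big (fun s => (s, y) ∈ A))

theorem thick0 : ThickOn L (M := M) PUnit.{u+1} (fun P => P PUnit.unit) where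
  mono P Q h1 h2 := h2 _ h1
  ne P h := ⟨_, h⟩
  of P Q _ _ h := h
  dfn δ _ A hA := by
    exact hA.out.comp (f := fun a : δ => (a, PUnit.unit))
      (DefF.pair (hf := DefF.id') (hg := DefF.const' PUnit.unit))
  flip A hA h := h

theorem thickS (T : (γ → Prop) → Prop) (hT : ThickOn L (M := M) γ T) :
    ThickOn L (M := M) (M × γ) (fun P => Big (fun s => T (fun y => P (s, y)))) where
  mono P Q h1 h2 := h1.mono fun s hs => hT.mono _ _ hs fun y hy => h2 _ hy
  ne P h := by
    obtain ⟨a, b, hab, h⟩ := h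
    obtain ⟨s, h1, h2⟩ := exbt hab
    obtain ⟨y, hy⟩ := hT.ne _ (h s h1 h2)
    exact ⟨_, hy⟩
  of P Q hP hQ h := by
    obtain ⟨P, hP', rfl⟩ := exSet L M P
    obtain ⟨Q, hQ', rfl⟩ := exSet L M Q
    have d1 := hT.dfn M P hP'
    have d2 := hT.dfn M Q hQ'
    apply Big.or L
    exact h.mono fun s hs => hT.of (fun y => (s, y) ∈ P) (fun y => (s, y) ∈ Q) inferInstance
      inferInstance hs
  dfn δ _ A hA := by
    have d := hT.dfn (δ × M) {p | (p.1.1, (p.1.2, p.2)) ∈ A} inferInstance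
    obtain ⟨Y, hY, he⟩ := exSet L M (fun a : δ × M => T (fun y => (a.1, (a.2, y)) ∈ A)) (h := d)
    have he' : ∀ (a : δ) (s : M), T (fun y => (a, (s, y)) ∈ A) ↔ (a, s) ∈ Y := fun a s => by
      have := congrFun he (a, s); simp only at this; rw [this]
    simp only [he']
    infer_instance
  flip A hA h := by
    have d : DefP L M (fun p : M × M => T fun y => (p.1, (p.2, y)) ∈ A) :=
      hT.dfn (M × M) {p | (p.1.1, (p.1.2, p.2)) ∈ A} inferInstance
    have h1 := fubini L (fun t s => T (fun y => (t, (s, y)) ∈ A)) h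
    exact h1.mono fun s hs => hT.flip {p | (p.1, (s, p.2)) ∈ A} inferInstance hs

def UF (α : Type u) [Crd M α] : Prop :=
  ∀ X : Set (α × M), DefS L M X → (∀ a, {y | (a, y) ∈ X}.Finite) →
    ∃ K, ∀ a, {y | (a, y) ∈ X}.ncard ≤ K

def QQ (β γ : Type u) [Crd M β] [Crd M γ] (T : (γ → Prop) → Prop) : Prop :=
  ∀ (A : Set (β × γ)) (X : Set ((β × γ) × M)), DefS L M A → DefS L M X →
    (∀ a, {y | (a, y) ∈ X}.Finite) →
    (∀ x y, (x, y) ∈ A → T (fun y => (x, y) ∈ A)) →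
    (∀ x y y', (x, y) ∈ A → (x, y') ∈ A → {z | ((x, y), z) ∈ X}.ncard = {z | ((x, y'), z) ∈ X}.ncard) →
    ∃ K, ∀ x y, (x, y) ∈ A → {z | ((x, y), z) ∈ X}.ncard ≤ K

theorem UF.surj (h : UF L (M := M) α) (f : α → β) (hf : DefF L M f) (hs : Function.Surjective f) :
    UF L (M := M) β := by
  intro X hX hfin
  have hd : DefP L M (fun p : α × M => (f p.1, p.2) ∈ X) :=
    hX.out.comp (f := fun p : α × M => (f p.1, p.2))
      (by have := hf.comp (f := (Prod.fst : α × M → α)) inferInstance; infer_instance)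
  obtain ⟨K, hK⟩ := h {p | (f p.1, p.2) ∈ X} inferInstance (fun a => hfin (f a))
  refine ⟨K, fun b => ?_⟩
  obtain ⟨a, rfl⟩ := hs b
  exact hK a

theorem QQ_base (T : (γ → Prop) → Prop) : QQ L (M := M) PUnit.{u+1} γ T := by
  intro A X _ _ _ _ hc
  by_cases h : ∃ y, (PUnit.unit, y) ∈ A
  · obtain ⟨y, hy⟩ := h
    exact ⟨{z | ((PUnit.unit, y), z) ∈ X}.ncard, fun x y' hy' => (hc _ _ _ hy' hy).le⟩
  · push Not at h
    exact ⟨0, fun x y hy => absurd hy (h y)⟩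

theorem QQ_UF (h : QQ L (M := M) α PUnit.{u+1} (fun P => P PUnit.unit)) : UF L (M := M) α := by
  intro X hX hfin
  obtain ⟨K, hK⟩ := h univ {p | (p.1.1, p.2) ∈ X} ⟨by simp only [mem_univ]; infer_instance⟩ inferInstance
    (fun a => hfin a.1) (fun x y _ => trivial) (fun x y y' _ _ => rfl)
  exact ⟨K, fun a => hK a PUnit.unit trivial⟩

theorem bd_open (P : M → Prop) (hop : ∀ s, P s → Ev s P) (s : M) (hs : P s) : ¬ bd P s := by
  intro h
  obtain ⟨i, j, hi, hj, h1⟩ := hop s hs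
  obtain ⟨-, x, h2, h3, h4⟩ := h i j hi hj
  exact h4 (h1 x h2 h3)

theorem QQ_step (T : (γ → Prop) → Prop) (hT : ThickOn L (M := M) γ T)
    (hQ : QQ L (M := M) β (M × γ) (fun P => Big (fun s => T (fun y => P (s, y)))))
    (hU : UF L (M := M) β) (hU' : UF L (M := M) (β × γ)) : QQ L (M := M) (β × M) γ T := by
  intro A X hA hX hfin hth hc
  -- good locus
  obtain ⟨Gd, hGd, hGdd⟩ : ∃ Gd : Set ((β × γ) × M), (∀ x y s, ((x, y), s) ∈ Gd ↔
      Good (fun s z => (((x, s), y), z) ∈ X) s) ∧ DefS L M Gd := by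
    have := defGood L (α := β × γ) {p | (((p.1.1, p.2.1), p.1.2), p.2.2) ∈ X}
    exact ⟨{p | Good (fun s z => (((p.1.1, s), p.1.2), z) ∈ X) p.2}, fun _ _ _ => Iff.rfl, ⟨this⟩⟩
  obtain ⟨B, hB, hBd⟩ : ∃ B : Set (β × M), (∀ x s, (x, s) ∈ B ↔
      ∃ y, Ev s (fun s' => ((x, s'), y) ∈ A ∧ ((x, y), s') ∈ Gd)) ∧ DefS L M B :=
    ⟨{p | ∃ y, Ev p.2 (fun s' => ((p.1, s'), y) ∈ A ∧ ((p.1, y), s') ∈ Gd)},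
      fun _ _ => Iff.rfl, inferInstance⟩
  obtain ⟨N, hN, hNd⟩ : ∃ N : Set (β × M), (∀ x s, (x, s) ∈ N ↔
      (∃ y, ((x, s), y) ∈ A) ∧ (x, s) ∉ B) ∧ DefS L M N :=
    ⟨{p | (∃ y, (p, y) ∈ A) ∧ p ∉ B}, fun _ _ => Iff.rfl, inferInstance⟩
  have hNf : ∀ x, {s | (x, s) ∈ N}.Finite := by
    intro x
    apply fin_of_not_big L
    intro hBig
    have hTd1 := hT.dfn M {p | (x, p.1) ∈ N ∧ ((x, p.1), p.2) ∈ A ∧ ((x, p.2), p.1) ∈ Gd} inferInstance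
    have hTd2 := hT.dfn M {p | (x, p.1) ∈ N ∧ ((x, p.1), p.2) ∈ A ∧ ((x, p.2), p.1) ∉ Gd} inferInstance
    have h1 : Big (fun s =>
        T (fun y => (s, y) ∈ {p : M × γ | (x, p.1) ∈ N ∧ ((x, p.1), p.2) ∈ A ∧ ((x, p.2), p.1) ∈ Gd}) ∨
        T (fun y => (s, y) ∈ {p : M × γ | (x, p.1) ∈ N ∧ ((x, p.1), p.2) ∈ A ∧ ((x, p.2), p.1) ∉ Gd})) := by
      refine hBig.mono fun s hs => ?_
      obtain ⟨⟨y, hy⟩, -⟩ := (hN x s).1 hs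
      refine hT.of _ _ inferInstance inferInstance (hT.mono _ _ (hth _ _ hy) fun y hy => ?_)
      by_cases h : ((x, y), s) ∈ Gd
      · exact Or.inl ⟨hs, hy, h⟩
      · exact Or.inr ⟨hs, hy, h⟩
    rcases Big.or L h1 with h2 | h2
    · obtain ⟨y, a, b, hab, h3⟩ := hT.ne _ (hT.flip _ inferInstance h2)
      obtain ⟨s, hs1, hs2⟩ := exbt hab
      refine ((hN x s).1 (h3 s hs1 hs2).1).2 ((hB x s).2 ⟨y, a, b, hs1, hs2, fun s' h4 h5 => ?_⟩)
      exact (h3 s' h4 h5).2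
    · obtain ⟨y, h3⟩ := hT.ne _ (hT.flip _ inferInstance h2)
      refine not_big_not_good L (fun s z => (((x, s), y), z) ∈ X) (fun s => hfin _) (h3.mono ?_)
      intro s hs hg
      exact hs.2.2 ((hGd _ _ _).2 hg)
  have hAB : ∀ x s y, ((x, s), y) ∈ A → (x, s) ∈ N ∨ (x, s) ∈ B := by
    intro x s y h
    by_cases hb : (x, s) ∈ B
    · exact Or.inr hb
    · exact Or.inl ((hN x s).2 ⟨⟨y, h⟩, hb⟩)
  -- bound over N
  have hb1 : ∃ K, ∀ x s y, ((x, s), y) ∈ A → (x, s) ∈ N → {z | (((x, s), y), z) ∈ X}.ncard ≤ K := by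
    obtain ⟨K1, hK1⟩ := hU N hNd hNf
    have : ∀ i, ∃ K, ∀ a : β × γ, {z | ∃ s, (a.1, s) ∈ Gr N i ∧ (((a.1, s), a.2), z) ∈ X}.ncard ≤ K := by
      intro i
      have := def_Gr L N hNf i
      refine hU' {p | ∃ s, (p.1.1, s) ∈ Gr N i ∧ (((p.1.1, s), p.1.2), p.2) ∈ X} inferInstance ?_
      intro a
      by_cases h : ∃ s, (a.1, s) ∈ Gr N i
      · obtain ⟨s, hs⟩ := h
        refine (hfin ((a.1, s), a.2)).subset ?_
        rintro z ⟨s', hs', hz⟩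
        rw [Gr_fun N hNf i a.1 s s' hs hs']
        exact hz
      · refine Set.finite_empty.subset ?_
        rintro z ⟨s', hs', hz⟩
        exact h ⟨s', hs'⟩
    choose Kf hKf using this
    refine ⟨(Finset.range K1).sup Kf, fun x s y _ hs => ?_⟩
    obtain ⟨i, hi, hsi⟩ := Gr_ex N hNf K1 hK1 x s hs
    refine le_trans ?_ (Finset.le_sup (f := Kf) (Finset.mem_range.2 hi))
    refine le_trans (le_of_eq ?_) (hKf i (x, y))
    congr 1
    ext z
    constructor
    · intro hz; exact ⟨s, hsi, hz⟩
    · rintro ⟨s', hs', hz⟩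
      rw [Gr_fun N hNf i x s s' hsi hs']
      exact hz
  -- B is open
  have hBo : ∀ x s, (x, s) ∈ B → Ev s (fun s' => (x, s') ∈ B) := by
    intro x s h
    obtain ⟨y, i, j, hi, hj, h1⟩ := (hB x s).1 h
    exact ⟨i, j, hi, hj, fun s' h2 h3 => (hB x s').2 ⟨y, i, j, h2, h3, h1⟩⟩
  have hBA : ∀ x s, (x, s) ∈ B → ∃ y, ((x, s), y) ∈ A := by
    intro x s h
    obtain ⟨y, hy⟩ := (hB x s).1 h
    exact ⟨y, hy.self.1⟩
  have hc0 : ∀ x s y, ((x, s), y) ∈ A → ∃ k, ∀ y', ((x, s), y') ∈ A → {z | (((x, s), y'), z) ∈ X}.ncard = k :=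
    fun x s y hy => ⟨_, fun y' hy' => hc _ _ _ hy' hy⟩
  have hc1 : ∀ x s, ∃ k, ((∃ y, ((x, s), y) ∈ A) ∨ k = 0) ∧
      ∀ y', ((x, s), y') ∈ A → {z | (((x, s), y'), z) ∈ X}.ncard = k := by
    intro x s
    by_cases h : ∃ y, ((x, s), y) ∈ A
    · obtain ⟨y, hy⟩ := h
      obtain ⟨k, hk⟩ := hc0 x s y hy
      exact ⟨k, Or.inl ⟨y, hy⟩, hk⟩
    · exact ⟨0, Or.inr rfl, fun y hy => absurd ⟨y, hy⟩ h⟩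
  choose c hce hcc using hc1
  have hcd : ∀ x k, DefP L M (fun s => c x s = k) := by
    intro x k
    have h1 := def_ncard_eq L k X hfin
    obtain ⟨Y, hY, he⟩ := exSet L M (fun a : (β × M) × γ => {z | (a, z) ∈ X}.ncard = k)
    have he' : ∀ a : (β × M) × γ, {z | (a, z) ∈ X}.ncard = k ↔ a ∈ Y := fun a =>
      iff_of_eq (congrFun he a)
    refine (inferInstance : DefP L M (fun s => (∃ y, ((x, s), y) ∈ A ∧ ((x, s), y) ∈ Y) ∨
      ((¬ ∃ y, ((x, s), y) ∈ A) ∧ k = 0))).congr fun s => ?_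
    have he2 : (∃ y, ((x, s), y) ∈ A ∧ ((x, s), y) ∈ Y) ↔ ∃ y, ((x, s), y) ∈ A ∧ {z | (((x, s), y), z) ∈ X}.ncard = k :=
      exists_congr fun y => and_congr_right fun _ => (he' _).symm
    rw [he2]
    constructor
    · rintro rfl
      by_cases h : ∃ y, ((x, s), y) ∈ A
      · obtain ⟨y, hy⟩ := h
        exact Or.inl ⟨y, hy, hcc x s y hy⟩
      · exact Or.inr ⟨h, (hce x s).resolve_left h⟩
    · rintro (⟨y, hy, h⟩ | ⟨h, rfl⟩)
      · rw [← hcc x s y hy, h]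
      · exact (hce x s).resolve_left h
  have hcloc : ∀ x s, (x, s) ∈ B → Ev s (fun s' => c x s' = c x s) := by
    intro x s h
    obtain ⟨y, hy⟩ := (hB x s).1 h
    have hg := (hGd _ _ _).1 hy.self.2
    have h1 := good_ncard L (fun s z => (((x, s), y), z) ∈ X) (fun s => hfin ((x, s), y)) s hg
    refine (hy.and h1).mono ?_
    rintro s' ⟨h2, h3⟩
    rw [← hcc x s' y h2.1, ← hcc x s y hy.self.1]
    exact h3
  -- boundary of B
  obtain ⟨H, hH, hHd⟩ : ∃ H : Set (β × M), (∀ x s, (x, s) ∈ H ↔ bd (fun s => (x, s) ∈ B) s) ∧ DefS L M H :=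
    ⟨{p | bd (fun s => (p.1, s) ∈ B) p.2}, fun _ _ => Iff.rfl, inferInstance⟩
  have hHf : ∀ x, {s | (x, s) ∈ H}.Finite := by
    intro x
    simp only [hH]
    exact bd_fin L (fun s => (x, s) ∈ B)
  have hHB : ∀ x s, (x, s) ∈ B → (x, s) ∉ H := fun x s h h' =>
    bd_open (fun s => (x, s) ∈ B) (hBo x) s h ((hH _ _).1 h')
  obtain ⟨K2, hK2⟩ := hU H hHd hHf
  have hRd : ∀ r, DefP L M (fun p : β × M => {h | (p.1, h) ∈ H ∧ h < p.2}.ncard = r) := fun r =>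
    def_ncard_eq L r (α := β × M) {p | (p.1.1, p.2) ∈ H ∧ p.2 < p.1.2}
      (fun a => (hHf a.1).subset fun y hy => hy.1)
  have hb2 : ∀ r, ∃ K, ∀ x s y, ((x, s), y) ∈ A → (x, s) ∈ B → {h | (x, h) ∈ H ∧ h < s}.ncard = r →
      {z | (((x, s), y), z) ∈ X}.ncard ≤ K := by
    intro r
    have := hRd r
    obtain ⟨R, hR, he⟩ := exSet L M (fun p : β × M => {h | (p.1, h) ∈ H ∧ h < p.2}.ncard = r)
    have he' : ∀ x s, {h | (x, h) ∈ H ∧ h < s}.ncard = r ↔ (x, s) ∈ R := fun x s => by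
      have := congrFun he (x, s); simp only at this; rw [this]
    have key := hQ {p | (p.1, p.2.1) ∈ B ∧ (p.1, p.2.1) ∈ R ∧ ((p.1, p.2.1), p.2.2) ∈ A}
      {p | (((p.1.1, p.1.2.1), p.1.2.2), p.2) ∈ X} inferInstance inferInstance
      (fun a => hfin ((a.1, a.2.1), a.2.2)) ?_ ?_
    · obtain ⟨K, hK⟩ := key
      exact ⟨K, fun x s y h1 h2 h3 => hK x (s, y) ⟨h2, (he' _ _).1 h3, h1⟩⟩
    · rintro x ⟨s, y⟩ ⟨h1, h2, h3⟩
      obtain ⟨i, j, hi, hj, h4⟩ := hBo x s h1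
      refine ⟨i, j, hi.trans hj, fun s' h5 h6 => ?_⟩
      obtain ⟨y', hy'⟩ := hBA x s' (h4 s' h5 h6)
      refine hT.mono _ _ (hth _ _ hy') fun y hy => ⟨h4 s' h5 h6, ?_, hy⟩
      rw [← he'] at h2 ⊢
      rw [← h2]
      congr 1
      ext h
      constructor
      · rintro ⟨h7, h8⟩
        refine ⟨h7, ?_⟩
        by_contra hh
        exact hHB x h (h4 h (hi.trans_le (not_lt.1 hh)) (h8.trans h6)) h7
      · rintro ⟨h7, h8⟩
        refine ⟨h7, ?_⟩
        by_contra hh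
        exact hHB x h (h4 h (h5.trans_le (not_lt.1 hh)) (h8.trans hj)) h7
    · have main : ∀ x s s' y y', s ≤ s' → (x, s) ∈ B → (x, s) ∈ R → ((x, s), y) ∈ A →
          (x, s') ∈ B → (x, s') ∈ R → ((x, s'), y') ∈ A →
          {z | (((x, s), y), z) ∈ X}.ncard = {z | (((x, s'), y'), z) ∈ X}.ncard := by
        intro x s s' y y' hle h1 h2 h3 h1' h2' h3'
        rw [hcc x s y h3, hcc x s' y' h3']
        rw [← he'] at h2 h2'
        have heq : {h | (x, h) ∈ H ∧ h < s} = {h | (x, h) ∈ H ∧ h < s'} := by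
          apply Set.eq_of_subset_of_ncard_le
          · rintro h ⟨h4, h5⟩; exact ⟨h4, h5.trans_le hle⟩
          · rw [h2, h2']
          · exact (hHf x).subset fun y hy => hy.1
        have hno : ∀ h, s ≤ h → h ≤ s' → (x, h) ∉ H := by
          intro h h4 h5 h6
          rcases h5.eq_or_lt with rfl | h5
          · exact hHB x _ h1' h6
          · have : h ∈ {h | (x, h) ∈ H ∧ h < s} := by rw [heq]; exact ⟨h6, h5⟩
            exact absurd this.2 (not_lt.2 h4)
        apply loc_const L (c x) (hcd x) hle
        intro t h4 h5
        apply Ev.mono (hcloc x t ?_) (fun _ h => h)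
        by_contra hcon
        rcases h4.eq_or_lt with rfl | h4
        · exact hcon h1
        obtain ⟨b, h6, h7, h8⟩ := bd_between L (fun s => (x, s) ∈ B) h4 ⟨h1, hcon⟩
        exact hno b h6 (h7.trans h5) ((hH _ _).2 h8)
      rintro x ⟨s, y⟩ ⟨s', y'⟩ ⟨h1, h2, h3⟩ ⟨h1', h2', h3'⟩
      rcases le_total s s' with h | h
      · exact main x s s' y y' h h1 h2 h3 h1' h2' h3'
      · exact (main x s' s y' y h h1' h2' h3' h1 h2 h3).symm
  choose Kr hKr using hb2
  obtain ⟨K1, hK1⟩ := hb1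
  refine ⟨max K1 ((Finset.range (K2 + 1)).sup Kr), ?_⟩
  rintro ⟨x, s⟩ y hy
  rcases hAB x s y hy with h | h
  · exact (hK1 x s y hy h).trans (le_max_left _ _)
  · refine le_trans ?_ (le_max_right _ _)
    refine (hKr _ x s y hy h rfl).trans (Finset.le_sup (f := Kr) (Finset.mem_range.2 ?_))
    refine Nat.lt_succ_of_le ((Set.ncard_le_ncard (fun h hh => hh.1) (hHf x)).trans (hK2 x))

end
end OM


open FirstOrder Set
set_option linter.unusedSectionVars false
set_option linter.unusedVariables false
set_option synthInstance.maxHeartbeats 400000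
set_option synthInstance.maxSize 20000

namespace OM
universe u v w
section
variable (L : FirstOrder.Language.{v, w}) {M : Type u} [L.Structure M] [LinearOrder M] [OMin L M]
  [DenselyOrdered M] [NoMinOrder M] [NoMaxOrder M] [Nonempty M]
  {α β γ : Type u} [Crd M α] [Crd M β] [Crd M γ]


def Bt (M : Type u) : ℕ → Type u
  | 0 => PUnit.{u+1}
  | k + 1 => Bt M k × M

def Gt (M : Type u) : ℕ → Type u
  | 0 => PUnit.{u+1}
  | k + 1 => M × Gt M k

noncomputable instance crdBt (M : Type u) : ∀ k, Crd M (Bt M k)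
  | 0 => crdUnit M
  | k + 1 => @crdProd M (Bt M k) M (crdBt M k) _

noncomputable instance crdGt (M : Type u) : ∀ k, Crd M (Gt M k)
  | 0 => crdUnit M
  | k + 1 => @crdProd M M (Gt M k) _ (crdGt M k)

def TT (M : Type u) [LinearOrder M] : ∀ k, (Gt M k → Prop) → Prop
  | 0 => fun P => P PUnit.unit
  | k + 1 => fun P => Big (fun s : M => TT M k (fun y => P (s, y)))

theorem thickT (k : ℕ) : ThickOn L (M := M) (Gt M k) (TT M k) := by
  induction k with
  | zero => exact thick0 L
  | succ k ih => exact thickS L _ ih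

theorem assoc_surj (j : ℕ) : ∀ k m, m = k + j →
    ∃ f : Bt M m → Bt M k × Gt M j, DefF L M f ∧ Function.Surjective f := by
  induction j with
  | zero =>
    rintro k m rfl
    exact ⟨fun x => (x, PUnit.unit), DefF.pair (hf := DefF.id') (hg := DefF.const' (β := PUnit.{u+1}) PUnit.unit),
      fun y => ⟨y.1, rfl⟩⟩
  | succ j ih =>
    intro k m hm
    obtain ⟨f, hf, hs⟩ := ih (k + 1) m (by omega)
    have hg : DefF L M (fun p : (Bt M k × M) × Gt M j => (p.1.1, (p.1.2, p.2))) := inferInstance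
    refine ⟨fun x => ((f x).1.1, ((f x).1.2, (f x).2)), ?_, ?_⟩
    · exact DefF.comp (β := (Bt M k × M) × Gt M j) hg hf
    · rintro ⟨a, b, c⟩
      obtain ⟨x, hx⟩ := hs ((a, b), c)
      refine ⟨x, ?_⟩
      simp only [hx]

theorem UF_Bt (m : ℕ) : UF L (M := M) (Bt M m) := by
  induction m using Nat.strong_induction_on with
  | _ m ih =>
    have key : ∀ k j, k + j = m → QQ L (M := M) (Bt M k) (Gt M j) (TT M j) := by
      intro k
      induction k with
      | zero => intro j _; exact QQ_base L _
      | succ k ihk =>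
        intro j hj
        have h1 := ihk (j + 1) (by omega)
        obtain ⟨f, hf, hs⟩ := assoc_surj L (M := M) j k (k + j) rfl
        exact QQ_step L (TT M j) (thickT L j) h1 (ih k (by omega)) (UF.surj L (ih (k + j) (by omega)) f hf hs)
    exact QQ_UF L (key m 0 rfl)

theorem bt_fin (k : ℕ) : ∃ f : Bt M k → (Fin k → M), DefF L M f ∧ Function.Surjective f := by
  induction k with
  | zero => exact ⟨fun _ i => i.elim0, DefF.mkFin (fun i => i.elim0), fun y => ⟨PUnit.unit, funext fun i => i.elim0⟩⟩
  | succ k ih =>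
    obtain ⟨f, hf, hs⟩ := ih
    refine ⟨fun p : Bt M k × M => (Fin.snoc (f p.1) p.2 : Fin (k + 1) → M), ?_, ?_⟩
    · apply DefF.mkFin
      intro i
      refine Fin.lastCases ?_ (fun j => ?_) i
      · simp only [Fin.snoc_last]
        exact DefF.snd0
      · simp only [Fin.snoc_castSucc]
        have : DefF L M (fun a : Bt M k × M => f a.1) := hf.comp DefF.fst0
        exact DefF.coord (hf := this) j
    · intro y
      obtain ⟨x, hx⟩ := hs (Fin.init y)
      refine ⟨(x, y (Fin.last k)), ?_⟩
      simp only [hx]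
      exact Fin.snoc_init_self y

theorem fin_crd (α : Type u) [Crd M α] : ∃ k, ∃ f : (Fin k → M) → α, ∃ g : α → (Fin k → M),
    DefF L M f ∧ DefF L M g ∧ (∀ a, f (g a) = a) := by
  have := Crd.fin (M := M) (α := α)
  obtain ⟨k, ⟨σ⟩⟩ := Finite.exists_equiv_fin (Crd.ι M α)
  refine ⟨k, fun x => Crd.e.symm (fun i => x (σ i)), fun a i => Crd.e a (σ.symm i), ⟨?_⟩, ⟨?_⟩, ?_⟩
  · intro i
    simp only [Equiv.apply_symm_apply]
    exact DefinableFun.proj L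
  · intro i
    change (univ : Set M).DefinableFun L (fun x : Crd.ι M α → M => Crd.e (Crd.e.symm x : α) (σ.symm i))
    simp only [Equiv.apply_symm_apply]
    exact DefinableFun.proj L
  · intro a
    simp

theorem uf (α : Type u) [Crd M α] : UF L (M := M) α := by
  obtain ⟨k, f, g, hf, hg, hfg⟩ := fin_crd L (M := M) α
  obtain ⟨f', hf', hs'⟩ := bt_fin L (M := M) k
  exact UF.surj L (UF.surj L (UF_Bt L k) f' hf' hs') f hf (fun a => ⟨g a, hfg a⟩)

end
end OM


open FirstOrder Set
set_option linter.unusedSectionVars false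
set_option linter.unusedVariables false
set_option synthInstance.maxHeartbeats 400000
set_option synthInstance.maxSize 20000

namespace OM
universe u v w
section
variable (L : FirstOrder.Language.{v, w}) {M : Type u} [L.Structure M] [LinearOrder M] [OMin L M]
  [DenselyOrdered M] [NoMinOrder M] [NoMaxOrder M] [Nonempty M]
  {α β γ : Type u} [Crd M α] [Crd M β] [Crd M γ]


structure IsFam {ω α : Type u} [Crd M ω] [Crd M α] (W : Set ω) (S : Set (ω × α)) : Prop where
  hW : DefS L M W
  hS : DefS L M S
  nw : ∃ u, u ∈ W
  ne : ∀ u ∈ W, ∃ a, (u, a) ∈ S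
  dir : ∀ u ∈ W, ∀ v ∈ W, ∃ w ∈ W, ∀ a, (w, a) ∈ S → (u, a) ∈ S ∧ (v, a) ∈ S

def Cpl {ω α : Type u} [Crd M ω] [Crd M α] (W : Set ω) (S : Set (ω × α)) : Prop :=
  ∀ X : Set α, DefS L M X → ∃ u ∈ W, (∀ a, (u, a) ∈ S → a ∈ X) ∨ (∀ a, (u, a) ∈ S → a ∉ X)

def Finer {ω ω' α : Type u} (W' : Set ω') (S' : Set (ω' × α)) (W : Set ω) (S : Set (ω × α)) : Prop :=
  ∀ u ∈ W, ∃ u' ∈ W', ∀ a, (u', a) ∈ S' → (u, a) ∈ S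

def Aq {δ α : Type u} (V : Set δ) (D : Set (δ × α)) (P : α → Prop) : Prop :=
  ∃ d ∈ V, ∀ a, (d, a) ∈ D → P a

section
variable {δ : Type u} [Crd M δ] {V : Set δ} {D : Set (δ × α)}

theorem Aq.mono {P Q : α → Prop} (h : Aq V D P) (hPQ : ∀ a, P a → Q a) : Aq V D Q := by
  obtain ⟨d, hd, h⟩ := h
  exact ⟨d, hd, fun a ha => hPQ a (h a ha)⟩

theorem Aq.and (hD : IsFam L (M := M) V D) {P Q : α → Prop} (h : Aq V D P) (h' : Aq V D Q) :
    Aq V D (fun a => P a ∧ Q a) := by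
  obtain ⟨d, hd, h⟩ := h
  obtain ⟨d', hd', h'⟩ := h'
  obtain ⟨e, he, h2⟩ := hD.dir d hd d' hd'
  exact ⟨e, he, fun a ha => ⟨h a (h2 a ha).1, h' a (h2 a ha).2⟩⟩

theorem Aq.ex (hD : IsFam L (M := M) V D) {P : α → Prop} (h : Aq V D P) : ∃ a, P a := by
  obtain ⟨d, hd, h⟩ := h
  obtain ⟨a, ha⟩ := hD.ne d hd
  exact ⟨a, h a ha⟩

theorem Aq.of_mem {d : δ} (hd : d ∈ V) : Aq V D (fun a => (d, a) ∈ D) := ⟨d, hd, fun _ h => h⟩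

theorem Aq.em (hC : Cpl L (M := M) V D) (P : α → Prop) [hP : DefP L M P] : Aq V D P ∨ Aq V D (fun a => ¬ P a) := by
  obtain ⟨d, hd, h | h⟩ := hC {a | P a} ⟨hP⟩
  · exact Or.inl ⟨d, hd, h⟩
  · exact Or.inr ⟨d, hd, h⟩

theorem Aq.all (hD : IsFam L (M := M) V D) (P : ℕ → α → Prop) (h : ∀ i, Aq V D (P i)) (n : ℕ) :
    Aq V D (fun a => ∀ i, i < n → P i a) := by
  induction n with
  | zero =>
    obtain ⟨d, hd⟩ := hD.nw
    exact ⟨d, hd, fun a _ i hi => absurd hi (Nat.not_lt_zero _)⟩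
  | succ n ih =>
    refine (Aq.and L hD ih (h n)).mono ?_
    rintro a ⟨h1, h2⟩ i hi
    rcases Nat.lt_succ_iff_lt_or_eq.1 hi with h | rfl
    · exact h1 i h
    · exact h2

theorem Aq.below (hD : IsFam L (M := M) V D) {P : α → Prop} (h : Aq V D P) {d1 d2 : δ} (h1 : d1 ∈ V) (h2 : d2 ∈ V) :
    ∃ d ∈ V, ∀ a, (d, a) ∈ D → P a ∧ (d1, a) ∈ D ∧ (d2, a) ∈ D := by
  obtain ⟨d, hd, h3⟩ := Aq.and L hD h (Aq.and L hD (Aq.of_mem h1) (Aq.of_mem h2))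
  exact ⟨d, hd, h3⟩

structure OF {δ ω : Type u} [Crd M δ] [Crd M ω] (V : Set δ) (D : Set (δ × α)) (W : Set ω)
    (S : Set (ω × (α × M))) : Prop where
  hW : DefS L M W
  hS : DefS L M S
  nw : ∃ u, u ∈ W
  ov : ∀ u ∈ W, Aq V D (fun a => ∃ t, (u, (a, t)) ∈ S)
  dir : ∀ u ∈ W, ∀ v ∈ W, ∃ w ∈ W, ∀ a t, (w, (a, t)) ∈ S → (u, (a, t)) ∈ S ∧ (v, (a, t)) ∈ S

theorem OF.dirFin {ω : Type u} [Crd M ω] {W : Set ω} {S : Set (ω × (α × M))} (hF : OF L V D W S)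
    (v : ℕ → ω) (hv : ∀ i, v i ∈ W) (u : ω) (hu : u ∈ W) (n : ℕ) :
    ∃ w ∈ W, (∀ a t, (w, (a, t)) ∈ S → (u, (a, t)) ∈ S) ∧
      ∀ i, i < n → ∀ a t, (w, (a, t)) ∈ S → (v i, (a, t)) ∈ S := by
  induction n with
  | zero => exact ⟨u, hu, fun _ _ h => h, fun i hi => absurd hi (Nat.not_lt_zero _)⟩
  | succ n ih =>
    obtain ⟨w, hw, h1, h2⟩ := ih
    obtain ⟨w', hw', h3⟩ := hF.dir w hw (v n) (hv n)
    refine ⟨w', hw', fun a t h => h1 a t (h3 a t h).1, fun i hi a t h => ?_⟩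
    rcases Nat.lt_succ_iff_lt_or_eq.1 hi with hi | rfl
    · exact h2 i hi a t (h3 a t h).1
    · exact (h3 a t h).2

theorem M1 {ω : Type u} [Crd M ω] {W : Set ω} {S : Set (ω × (α × M))} (hD : IsFam L (M := M) V D) (hC : Cpl L (M := M) V D)
    (hF : OF L V D W S) (G : Set (α × M)) (hG : DefS L M G)
    (hGf : ∀ a t t', (a, t) ∈ G → (a, t') ∈ G → t = t')
    (hGS : ∀ u ∈ W, Aq V D (fun a => ∃ t, (a, t) ∈ G ∧ (u, (a, t)) ∈ S)) :
    ∃ (ω' : Type u) (_ : Crd M ω') (W' : Set ω') (S' : Set (ω' × (α × M))),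
      IsFam L (M := M) W' S' ∧ Cpl L (M := M) W' S' ∧ Finer W' S' W S := by
  have := hD.hW
  have := hD.hS
  obtain ⟨u0, hu0⟩ := hF.nw
  obtain ⟨d0, hd0, h0⟩ := hGS u0 hu0
  have hdom : ∀ a, (d0, a) ∈ D → ∃ t, (a, t) ∈ G := fun a ha => by
    obtain ⟨t, ht, _⟩ := h0 a ha; exact ⟨t, ht⟩
  refine ⟨δ, inferInstance, {d | d ∈ V ∧ ∀ a, (d, a) ∈ D → ∃ t, (a, t) ∈ G},
    {p | (p.1, p.2.1) ∈ D ∧ p.2 ∈ G}, ⟨inferInstance, inferInstance, ⟨d0, hd0, hdom⟩, ?_, ?_⟩, ?_, ?_⟩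
  · rintro d ⟨h1, h2⟩
    obtain ⟨a, ha⟩ := hD.ne d h1
    obtain ⟨t, ht⟩ := h2 a ha
    exact ⟨(a, t), ha, ht⟩
  · rintro d ⟨h1, h2⟩ d' ⟨h1', h2'⟩
    obtain ⟨e, he, h3⟩ := hD.dir d h1 d' h1'
    refine ⟨e, ⟨he, fun a ha => h2 a (h3 a ha).1⟩, ?_⟩
    rintro ⟨a, t⟩ ⟨h4, h5⟩
    exact ⟨⟨(h3 a h4).1, h5⟩, ⟨(h3 a h4).2, h5⟩⟩
  · intro X hX
    rcases Aq.em L hC (fun a => ∃ t, (a, t) ∈ G ∧ (a, t) ∈ X) with h | h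
    · obtain ⟨d, hd, h1⟩ := Aq.below L hD h hd0 hd0
      refine ⟨d, ⟨hd, fun a ha => hdom a (h1 a ha).2.1⟩, Or.inl ?_⟩
      rintro ⟨a, t⟩ ⟨h2, h3⟩
      obtain ⟨⟨t', h4, h5⟩, -⟩ := h1 a h2
      rw [hGf a t t' h3 h4]
      exact h5
    · obtain ⟨d, hd, h1⟩ := Aq.below L hD h hd0 hd0
      refine ⟨d, ⟨hd, fun a ha => hdom a (h1 a ha).2.1⟩, Or.inr ?_⟩
      rintro ⟨a, t⟩ ⟨h2, h3⟩ h4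
      exact (h1 a h2).1 ⟨t, h3, h4⟩
  · intro u hu
    obtain ⟨d, hd, h1⟩ := hGS u hu
    refine ⟨d, ⟨hd, fun a ha => ?_⟩, ?_⟩
    · obtain ⟨t, ht, _⟩ := h1 a ha; exact ⟨t, ht⟩
    rintro ⟨a, t⟩ ⟨h2, h3⟩
    obtain ⟨t', h4, h5⟩ := h1 a h2
    rw [hGf a t t' h3 h4]
    exact h5

theorem M3 {ω : Type u} [Crd M ω] {W : Set ω} {S : Set (ω × (α × M))} (hD : IsFam L (M := M) V D) (hC : Cpl L (M := M) V D)
    (hF : OF L V D W S)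
    (hconv : ∀ u ∈ W, ∀ a t1 t2 t, (u, (a, t1)) ∈ S → (u, (a, t2)) ∈ S → t1 ≤ t → t ≤ t2 → (u, (a, t)) ∈ S) :
    ∃ (ω' : Type u) (_ : Crd M ω') (W' : Set ω') (S' : Set (ω' × (α × M))),
      IsFam L (M := M) W' S' ∧ Cpl L (M := M) W' S' ∧ Finer W' S' W S := by
  have := hD.hW
  have := hD.hS
  have := hF.hW
  have := hF.hS
  by_cases hsec : ∃ G : Set (α × M), DefS L M G ∧ (∀ a t t', (a, t) ∈ G → (a, t') ∈ G → t = t') ∧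
      ∀ u ∈ W, Aq V D (fun a => ∃ t, (a, t) ∈ G ∧ (u, (a, t)) ∈ S)
  · obtain ⟨G, h1, h2, h3⟩ := hsec
    exact M1 L hD hC hF G h1 h2 h3
  push Not at hsec
  refine ⟨ω × δ, inferInstance, {p | p.1 ∈ W ∧ p.2 ∈ V ∧ ∀ a, (p.2, a) ∈ D → ∃ t, (p.1, (a, t)) ∈ S},
    {p | (p.1.2, p.2.1) ∈ D ∧ (p.1.1, p.2) ∈ S}, ⟨inferInstance, inferInstance, ?_, ?_, ?_⟩, ?_, ?_⟩
  · obtain ⟨u, hu⟩ := hF.nw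
    obtain ⟨d, hd, h⟩ := hF.ov u hu
    exact ⟨(u, d), hu, hd, h⟩
  · rintro ⟨u, d⟩ ⟨hu, hd, h⟩
    obtain ⟨a, ha⟩ := hD.ne d hd
    obtain ⟨t, ht⟩ := h a ha
    exact ⟨(a, t), ha, ht⟩
  · rintro ⟨u, d⟩ ⟨hu, hd, h⟩ ⟨u', d'⟩ ⟨hu', hd', h'⟩
    obtain ⟨w, hw, h1⟩ := hF.dir u hu u' hu'
    obtain ⟨e, he, h2⟩ := Aq.below L hD (hF.ov w hw) hd hd'
    refine ⟨(w, e), ⟨hw, he, fun a ha => (h2 a ha).1⟩, ?_⟩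
    rintro ⟨a, t⟩ ⟨h3, h4⟩
    exact ⟨⟨(h2 a h3).2.1, (h1 a t h4).1⟩, ⟨(h2 a h3).2.2, (h1 a t h4).2⟩⟩
  · intro X hX
    obtain ⟨Y, hY, hYd⟩ : ∃ Y : Set (α × M), (∀ a h, (a, h) ∈ Y ↔ bd (fun t => (a, t) ∈ X) h) ∧ DefS L M Y :=
      ⟨{p | bd (fun t => (p.1, t) ∈ X) p.2}, fun _ _ => Iff.rfl, inferInstance⟩
    have hYf : ∀ a, {h | (a, h) ∈ Y}.Finite := by
      intro a
      simp only [hY]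
      exact bd_fin L (fun t => (a, t) ∈ X)
    obtain ⟨K, hK⟩ := uf L (M := M) α Y hYd hYf
    have hv : ∀ i, ∃ v ∈ W, Aq V D (fun a => ¬ ∃ t, (a, t) ∈ Gr Y i ∧ (v, (a, t)) ∈ S) := by
      intro i
      have := def_Gr L Y hYf i
      obtain ⟨v, hv, hn⟩ := hsec (Gr Y i) this (Gr_fun Y hYf i)
      exact ⟨v, hv, (Aq.em L hC (fun a => ∃ t, (a, t) ∈ Gr Y i ∧ (v, (a, t)) ∈ S)).resolve_left hn⟩
    choose v hvW hvA using hv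
    obtain ⟨u0, hu0⟩ := hF.nw
    obtain ⟨w, hw, -, h2⟩ := OF.dirFin L hF v hvW u0 hu0 K
    have h3 := Aq.and L hD (hF.ov w hw) (Aq.all L hD _ hvA K)
    have hno : Aq V D (fun a => (∃ t, (w, (a, t)) ∈ S) ∧ ∀ t t', (w, (a, t)) ∈ S → (w, (a, t')) ∈ S →
        ((a, t) ∈ X ↔ (a, t') ∈ X)) := by
      refine h3.mono ?_
      rintro a ⟨h4, h5⟩
      have key : ∀ t t', t < t' → (w, (a, t)) ∈ S → (w, (a, t')) ∈ S → ((a, t) ∈ X ↔ (a, t') ∈ X) := by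
        intro t t' hlt ht ht'
        by_contra hcon
        obtain ⟨s, hs1, hs2, hs3⟩ := bd_between' L (fun t => (a, t) ∈ X) hlt hcon
        obtain ⟨i, hi, hs4⟩ := Gr_ex Y hYf K hK a s ((hY _ _).2 hs3)
        exact h5 i hi ⟨s, hs4, h2 i hi a s (hconv w hw a t t' s ht ht' hs1 hs2)⟩
      refine ⟨h4, fun t t' ht ht' => ?_⟩
      rcases lt_trichotomy t t' with h | rfl | h
      · exact key _ _ h ht ht'
      · exact Iff.rfl
      · exact (key _ _ h ht' ht).symm
    rcases Aq.em L hC (fun a => ∃ t, (w, (a, t)) ∈ S ∧ (a, t) ∈ X) with h | h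
    · obtain ⟨d, hd, h6⟩ := Aq.and L hD hno h
      refine ⟨(w, d), ⟨hw, hd, fun a ha => (h6 a ha).1.1⟩, Or.inl ?_⟩
      rintro ⟨a, t⟩ ⟨h7, h8⟩
      obtain ⟨⟨-, h9⟩, t', h10, h11⟩ := h6 a h7
      exact (h9 t t' h8 h10).2 h11
    · obtain ⟨d, hd, h6⟩ := Aq.and L hD hno h
      refine ⟨(w, d), ⟨hw, hd, fun a ha => (h6 a ha).1.1⟩, Or.inr ?_⟩
      rintro ⟨a, t⟩ ⟨h7, h8⟩ h9
      exact (h6 a h7).2 ⟨t, h8, h9⟩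
  · intro u hu
    obtain ⟨d, hd, h⟩ := hF.ov u hu
    refine ⟨(u, d), ⟨hu, hd, h⟩, ?_⟩
    rintro ⟨a, t⟩ ⟨h1, h2⟩
    exact h2

end

def Alt : ℕ → (M → Prop) → M → Prop
  | 0, A, t => A t
  | k + 1, A, t => A t ∧ ∃ s t', t' < s ∧ s < t ∧ ¬ A s ∧ Alt k A t'

theorem Alt.self {k : ℕ} {A : M → Prop} {t : M} (h : Alt k A t) : A t := by
  cases k with
  | zero => exact h
  | succ k => exact h.1

theorem Alt.up {k : ℕ} {A : M → Prop} {t t2 : M} (h : Alt k A t) (h2 : A t2) (hle : t ≤ t2) : Alt k A t2 := by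
  cases k with
  | zero => exact h2
  | succ k =>
    obtain ⟨-, s, t', h3, h4, h5⟩ := h
    exact ⟨h2, s, t', h3, h4.trans_le hle, h5⟩

def comp (i : ℕ) (A : M → Prop) (t : M) : Prop := Alt i A t ∧ ¬ Alt (i + 1) A t

theorem comp_conv (i : ℕ) (A : M → Prop) {t1 t2 x : M} (h1 : comp i A t1) (h2 : comp i A t2) (hx1 : t1 ≤ x)
    (hx2 : x ≤ t2) : comp i A x := by
  have hA : A x := by
    by_contra hcon
    apply h2.2
    refine ⟨h2.1.self, x, t1, lt_of_le_of_ne hx1 ?_, lt_of_le_of_ne hx2 ?_, hcon, h1.1⟩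
    · rintro rfl; exact hcon h1.1.self
    · rintro rfl; exact hcon h2.1.self
  exact ⟨h1.1.up hA hx1, fun h => h2.2 (h.up h2.1.self hx2)⟩

theorem comp_ex (K : ℕ) (A : M → Prop) (t : M) (h : A t) (hK : ¬ Alt K A t) : ∃ i, i < K ∧ comp i A t := by
  induction K with
  | zero => exact absurd h hK
  | succ K ih =>
    by_cases h' : Alt K A t
    · exact ⟨K, Nat.lt_succ_self _, h', hK⟩
    · obtain ⟨i, hi, h1⟩ := ih h'
      exact ⟨i, hi.trans (Nat.lt_succ_self _), h1⟩

theorem alt_comb (B C : M → Prop) (hC : ∀ t1 t2 x, C t1 → C t2 → t1 ≤ x → x ≤ t2 → C x) {s b1 b2 : M}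
    (hsC : ¬ C s) (hsB : ¬ B s) (h1 : b1 < s) (h2 : s < b2) (hb1 : B b1) (hb2 : B b2) (k : ℕ) (t : M)
    (h : Alt k (fun t => B t ∧ C t) t) : ∃ t', Alt (k + 1) B t' := by
  have e1 : ∀ k t, Alt k (fun t => B t ∧ C t) t → Alt k B t := by
    intro k
    induction k with
    | zero => intro t h; exact h.1
    | succ k ih =>
      rintro t ⟨h3, s', t', h4, h5, h6, h7⟩
      exact ⟨h3.1, s', t', h4, h5, fun hB => h6 ⟨hB, hC _ _ _ h7.self.2 h3.2 h4.le h5.le⟩, ih t' h7⟩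
  have e2 : ∀ k t, s < t → Alt k (fun t => B t ∧ C t) t → Alt (k + 1) B t := by
    intro k
    induction k with
    | zero => intro t hst h; exact ⟨h.1, s, b1, h1, hst, hsB, hb1⟩
    | succ k ih =>
      rintro t hst ⟨h3, s', t', h4, h5, h6, h7⟩
      refine ⟨h3.1, s', t', h4, h5, fun hB => h6 ⟨hB, hC _ _ _ h7.self.2 h3.2 h4.le h5.le⟩, ih t' ?_ h7⟩
      by_contra hcon
      exact hsC (hC _ _ _ h7.self.2 h3.2 (not_lt.1 hcon) hst.le)
  rcases lt_trichotomy s t with hst | rfl | hst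
  · exact ⟨t, e2 k t hst h⟩
  · exact absurd h.self.2 hsC
  · exact ⟨b2, hb2, s, t, hst, h2, hsB, e1 k t h⟩

theorem defAlt (k : ℕ) (X : Set (β × M)) [DefS L M X] :
    DefP L M (fun p : β × M => Alt k (fun z => (p.1, z) ∈ X) p.2) := by
  induction k with
  | zero => exact (inferInstance : DefP L M (fun p : β × M => (p.1, p.2) ∈ X))
  | succ k ih =>
    obtain ⟨Y, hY, he⟩ := exSet L M (fun p : β × M => Alt k (fun z => (p.1, z) ∈ X) p.2)
    have he' : ∀ b t, Alt k (fun z => (b, z) ∈ X) t ↔ (b, t) ∈ Y := fun b t => iff_of_eq (congrFun he (b, t))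
    simp only [Alt, he']
    infer_instance

theorem alt_bd (A : M → Prop) [DefP L M A] (k : ℕ) (t : M) (h : Alt k A t) :
    k ≤ {h | bd A h ∧ h ≤ t}.ncard := by
  have hf : ∀ t, {h | bd A h ∧ h ≤ t}.Finite := fun t => (bd_fin L A).subset fun h hh => hh.1
  induction k generalizing t with
  | zero => exact Nat.zero_le _
  | succ k ih =>
    obtain ⟨h1, s, t', h2, h3, h4, h5⟩ := h
    have h6 := ih t' h5
    obtain ⟨b, hb1, hb2, hb3⟩ := bd_between' L A h3 (by tauto)
    have h7 : insert b {h | bd A h ∧ h ≤ t'} ⊆ {h | bd A h ∧ h ≤ t} := by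
      rintro x (rfl | hx)
      · exact ⟨hb3, hb2⟩
      · exact ⟨hx.1, hx.2.trans (h2.trans h3).le⟩
    have h8 := Set.ncard_le_ncard h7 (hf t)
    rw [Set.ncard_insert_of_notMem (fun hh => absurd hh.2 (not_le.2 (h2.trans_le hb1))) (hf t')] at h8
    omega

theorem alt_bound (X : Set (β × M)) [DefS L M X] : ∃ K, ∀ b t, ¬ Alt K (fun z => (b, z) ∈ X) t := by
  obtain ⟨K, hK⟩ := uf L (M := M) β {p | bd (fun t => (p.1, t) ∈ X) p.2} inferInstance
    (fun b => bd_fin L (fun t => (b, t) ∈ X))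
  refine ⟨K + 1, fun b t h => ?_⟩
  have h1 := alt_bd L (fun t => (b, t) ∈ X) _ t h
  have h2 := Set.ncard_le_ncard (s := {h | bd (fun t => (b, t) ∈ X) h ∧ h ≤ t})
    (t := {h | bd (fun t => (b, t) ∈ X) h}) (fun x hx => hx.1) (bd_fin L (fun t => (b, t) ∈ X))
  have h3 : {h | bd (fun t => (b, t) ∈ X) h}.ncard ≤ K := hK b
  omega

end
end OM


open FirstOrder Set
set_option linter.unusedSectionVars false
set_option linter.unusedVariables false
set_option synthInstance.maxHeartbeats 400000
set_option synthInstance.maxSize 20000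

namespace OM
universe u v w
section
variable (L : FirstOrder.Language.{v, w}) {M : Type u} [L.Structure M] [LinearOrder M] [OMin L M]
  [DenselyOrdered M] [NoMinOrder M] [NoMaxOrder M] [Nonempty M]
  {α β γ : Type u} [Crd M α] [Crd M β] [Crd M γ]


theorem Finer.trans' {ω ω' ω'' : Type u} {W : Set ω} {S : Set (ω × α)} {W' : Set ω'} {S' : Set (ω' × α)}
    {W'' : Set ω''} {S'' : Set (ω'' × α)} (h1 : Finer W'' S'' W' S') (h2 : Finer W' S' W S) :
    Finer W'' S'' W S := by
  intro u hu
  obtain ⟨v, hv, h⟩ := h2 u hu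
  obtain ⟨w, hw, h'⟩ := h1 v hv
  exact ⟨w, hw, fun a ha => h a (h' a ha)⟩

section
variable {δ : Type u} [Crd M δ] {V : Set δ} {D : Set (δ × α)}

theorem M2 (hD : IsFam L (M := M) V D) (hC : Cpl L (M := M) V D) (K : ℕ) :
    ∀ {ω : Type u} [Crd M ω] (W : Set ω) (S : Set (ω × (α × M))), OF L V D W S →
    (∀ u ∈ W, ∀ a t, ¬ Alt K (fun t => (u, (a, t)) ∈ S) t) →
    ∃ (ω' : Type u) (_ : Crd M ω') (W' : Set ω') (S' : Set (ω' × (α × M))),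
      OF L V D W' S' ∧ Finer W' S' W S ∧
      ∀ u ∈ W', ∀ a t1 t2 t, (u, (a, t1)) ∈ S' → (u, (a, t2)) ∈ S' → t1 ≤ t → t ≤ t2 → (u, (a, t)) ∈ S' := by
  have := hD.hW
  have := hD.hS
  induction K with
  | zero =>
    intro ω _ W S hF hA
    obtain ⟨u, hu⟩ := hF.nw
    obtain ⟨a, t, ht⟩ := Aq.ex L hD (hF.ov u hu)
    exact absurd ht (hA u hu a t)
  | succ K ih =>
    intro ω _ W S hF hA
    have := hF.hW
    have := hF.hS
    by_cases hcase : ∀ u ∈ W, ∃ v ∈ W, Aq V D (fun a => ∀ t t1 t2, (v, (a, t1)) ∈ S → (v, (a, t2)) ∈ S →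
        t1 ≤ t → t ≤ t2 → (u, (a, t)) ∈ S)
    · refine ⟨ω × δ, inferInstance, {p | p.1 ∈ W ∧ p.2 ∈ V}, {p | (p.1.2, p.2.1) ∈ D ∧ ∃ t1 t2,
        (p.1.1, (p.2.1, t1)) ∈ S ∧ (p.1.1, (p.2.1, t2)) ∈ S ∧ t1 ≤ p.2.2 ∧ p.2.2 ≤ t2},
        ⟨inferInstance, inferInstance, ?_, ?_, ?_⟩, ?_, ?_⟩
      · obtain ⟨u, hu⟩ := hF.nw
        obtain ⟨d, hd⟩ := hD.nw
        exact ⟨(u, d), hu, hd⟩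
      · rintro ⟨u, d⟩ ⟨hu, hd⟩
        refine (Aq.and L hD (hF.ov u hu) (Aq.of_mem hd)).mono ?_
        rintro a ⟨⟨t, ht⟩, ha⟩
        exact ⟨t, ha, t, t, ht, ht, le_rfl, le_rfl⟩
      · rintro ⟨u, d⟩ ⟨hu, hd⟩ ⟨u', d'⟩ ⟨hu', hd'⟩
        obtain ⟨w, hw, h1⟩ := hF.dir u hu u' hu'
        obtain ⟨e, he, h2⟩ := hD.dir d hd d' hd'
        refine ⟨(w, e), ⟨hw, he⟩, ?_⟩
        rintro a t ⟨h3, t1, t2, h4, h5, h6, h7⟩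
        exact ⟨⟨(h2 a h3).1, t1, t2, (h1 _ _ h4).1, (h1 _ _ h5).1, h6, h7⟩,
          ⟨(h2 a h3).2, t1, t2, (h1 _ _ h4).2, (h1 _ _ h5).2, h6, h7⟩⟩
      · intro u hu
        obtain ⟨v, hv, d, hd, h⟩ := hcase u hu
        refine ⟨(v, d), ⟨hv, hd⟩, ?_⟩
        rintro ⟨a, t⟩ ⟨h3, t1, t2, h4, h5, h6, h7⟩
        exact h a h3 t t1 t2 h4 h5 h6 h7
      · rintro ⟨u, d⟩ - a t1 t2 t ⟨h3, r1, r2, h4, h5, h6, h7⟩ ⟨-, r1', r2', h4', h5', h6', h7'⟩ h8 h9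
        exact ⟨h3, r1, r2', h4, h5', h6.trans h8, h9.trans h7'⟩
    · push Not at hcase
      obtain ⟨u0, hu0, hcase⟩ := hcase
      obtain ⟨Cm, hCm⟩ : ∃ Cm : ℕ → Set (α × M), Cm = fun i => {p | comp i (fun t => (u0, (p.1, t)) ∈ S) p.2} :=
        ⟨_, rfl⟩
      have hCmd : ∀ i, DefS L M (Cm i) := by
        intro i
        have d1 := defAlt L (β := α) i {p : α × M | (u0, p) ∈ S}
        have d2 := defAlt L (β := α) (i + 1) {p : α × M | (u0, p) ∈ S}
        rw [hCm]
        exact ⟨DefP.and (hP := d1) (hQ := DefP.not (hP := d2))⟩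
      have hCmi : ∀ i a t, (a, t) ∈ Cm i ↔ comp i (fun t => (u0, (a, t)) ∈ S) t := by
        intro i a t; rw [hCm]; rfl
      have hpig : ∃ i, ∀ v ∈ W, Aq V D (fun a => ∃ t, (v, (a, t)) ∈ S ∧ (a, t) ∈ Cm i) := by
        by_contra hcon
        push Not at hcon
        choose v hv hn using hcon
        have hn' : ∀ i, Aq V D (fun a => ¬ ∃ t, (v i, (a, t)) ∈ S ∧ (a, t) ∈ Cm i) := fun i => by
          have := hCmd i
          exact (Aq.em L hC (fun a => ∃ t, (v i, (a, t)) ∈ S ∧ (a, t) ∈ Cm i)).resolve_left (hn i)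
        obtain ⟨w, hw, h1, h2⟩ := OF.dirFin L hF v hv u0 hu0 (K + 1)
        obtain ⟨a, ⟨t, ht⟩, h4⟩ := Aq.ex L hD (Aq.and L hD (hF.ov w hw) (Aq.all L hD _ hn' (K + 1)))
        obtain ⟨i, hi, h5⟩ := comp_ex (K + 1) (fun t => (u0, (a, t)) ∈ S) t (h1 a t ht) (hA u0 hu0 a t)
        exact h4 i hi ⟨t, h2 i hi a t ht, (hCmi i a t).2 h5⟩
      obtain ⟨i, hi⟩ := hpig
      have := hCmd i
      have hbad : ∀ v ∈ W, Aq V D (fun a => ∃ t t1 t2, (v, (a, t1)) ∈ S ∧ (v, (a, t2)) ∈ S ∧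
          t1 ≤ t ∧ t ≤ t2 ∧ (u0, (a, t)) ∉ S) := by
        intro v hv
        refine ((Aq.em L hC (fun a => ∀ t t1 t2, (v, (a, t1)) ∈ S → (v, (a, t2)) ∈ S →
          t1 ≤ t → t ≤ t2 → (u0, (a, t)) ∈ S)).resolve_left (hcase v hv)).mono ?_
        intro a ha
        push Not at ha
        exact ha
      have hnew : ∀ u ∈ W, ∀ d ∈ V, ∀ d' ∈ V, ∃ w ∈ W, ∃ e ∈ V, (∀ a t, (w, (a, t)) ∈ S → (u, (a, t)) ∈ S) ∧
          (∀ a t, (w, (a, t)) ∈ S → (u0, (a, t)) ∈ S) ∧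
          (∀ a, (e, a) ∈ D → ∃ t t1 t2, (w, (a, t1)) ∈ S ∧ (w, (a, t2)) ∈ S ∧
            t1 ≤ t ∧ t ≤ t2 ∧ (u0, (a, t)) ∉ S) ∧ ∀ a, (e, a) ∈ D → (d, a) ∈ D ∧ (d', a) ∈ D := by
        intro u hu d hd d' hd'
        obtain ⟨w, hw, h1⟩ := hF.dir u hu u0 hu0
        obtain ⟨e, he, h2⟩ := Aq.below L hD (hbad w hw) hd hd'
        exact ⟨w, hw, e, he, fun a t h => (h1 a t h).1, fun a t h => (h1 a t h).2,
          fun a h => (h2 a h).1, fun a h => (h2 a h).2⟩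
      obtain ⟨W1, hW1, hW1d⟩ : ∃ W1 : Set (ω × δ), (∀ v d, (v, d) ∈ W1 ↔ v ∈ W ∧ d ∈ V ∧
          (∀ a t, (v, (a, t)) ∈ S → (u0, (a, t)) ∈ S) ∧
          (∀ a, (d, a) ∈ D → ∃ t t1 t2, (v, (a, t1)) ∈ S ∧ (v, (a, t2)) ∈ S ∧
            t1 ≤ t ∧ t ≤ t2 ∧ (u0, (a, t)) ∉ S)) ∧ DefS L M W1 :=
        ⟨{p | p.1 ∈ W ∧ p.2 ∈ V ∧ (∀ a t, (p.1, (a, t)) ∈ S → (u0, (a, t)) ∈ S) ∧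
          (∀ a, (p.2, a) ∈ D → ∃ t t1 t2, (p.1, (a, t1)) ∈ S ∧ (p.1, (a, t2)) ∈ S ∧
            t1 ≤ t ∧ t ≤ t2 ∧ (u0, (a, t)) ∉ S)}, fun _ _ => Iff.rfl, inferInstance⟩
      obtain ⟨S1, hS1, hS1d⟩ : ∃ S1 : Set ((ω × δ) × (α × M)), (∀ v d a t, ((v, d), (a, t)) ∈ S1 ↔
          (d, a) ∈ D ∧ (v, (a, t)) ∈ S ∧ (a, t) ∈ Cm i) ∧ DefS L M S1 :=
        ⟨{p | (p.1.2, p.2.1) ∈ D ∧ (p.1.1, p.2) ∈ S ∧ p.2 ∈ Cm i}, fun _ _ _ _ => Iff.rfl, inferInstance⟩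
      have hfin : Finer W1 S1 W S := by
        intro u hu
        obtain ⟨d, hd⟩ := hD.nw
        obtain ⟨w, hw, e, he, h1, h2, h3, h4⟩ := hnew u hu d hd d hd
        refine ⟨(w, e), (hW1 _ _).2 ⟨hw, he, h2, h3⟩, ?_⟩
        rintro ⟨a, t⟩ h
        exact h1 _ _ ((hS1 _ _ _ _).1 h).2.1
      have hOF : OF L V D W1 S1 := by
        refine ⟨hW1d, hS1d, ?_, ?_, ?_⟩
        · obtain ⟨p, hp, -⟩ := hfin u0 hu0
          exact ⟨p, hp⟩
        · rintro ⟨v, d⟩ h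
          obtain ⟨hv, hd, h2, h3⟩ := (hW1 _ _).1 h
          refine (Aq.and L hD (hi v hv) (Aq.of_mem hd)).mono ?_
          rintro a ⟨⟨t, ht, ht'⟩, ha⟩
          exact ⟨t, (hS1 _ _ _ _).2 ⟨ha, ht, ht'⟩⟩
        · rintro ⟨v, d⟩ h ⟨v', d'⟩ h'
          obtain ⟨hv, hd, -, -⟩ := (hW1 _ _).1 h
          obtain ⟨hv', hd', -, -⟩ := (hW1 _ _).1 h'
          obtain ⟨u, hu, h5⟩ := hF.dir v hv v' hv'
          obtain ⟨w, hw, e, he, h1, h2, h3, h4⟩ := hnew u hu d hd d' hd'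
          refine ⟨(w, e), (hW1 _ _).2 ⟨hw, he, h2, h3⟩, ?_⟩
          intro a t h6
          obtain ⟨h7, h8, h9⟩ := (hS1 _ _ _ _).1 h6
          exact ⟨(hS1 _ _ _ _).2 ⟨(h4 a h7).1, (h5 _ _ (h1 _ _ h8)).1, h9⟩,
            (hS1 _ _ _ _).2 ⟨(h4 a h7).2, (h5 _ _ (h1 _ _ h8)).2, h9⟩⟩
      obtain ⟨ω', hω', W', S', h1, h2, h3⟩ := ih W1 S1 hOF (by
        rintro ⟨v, d⟩ h a t hAlt
        obtain ⟨hv, hd, h2, h3⟩ := (hW1 _ _).1 h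
        have ha : (d, a) ∈ D := ((hS1 _ _ _ _).1 hAlt.self).1
        obtain ⟨s, b1, b2, hb1, hb2, hs1, hs2, hs⟩ := h3 a ha
        have heq : (fun t => ((v, d), (a, t)) ∈ S1) =
            fun t => (v, (a, t)) ∈ S ∧ comp i (fun t => (u0, (a, t)) ∈ S) t := by
          funext t
          rw [hS1, hCmi]
          simp [ha]
        rw [heq] at hAlt
        have hsv : (v, (a, s)) ∉ S := fun h => hs (h2 _ _ h)
        obtain ⟨t', ht'⟩ := alt_comb (fun t => (v, (a, t)) ∈ S) (comp i (fun t => (u0, (a, t)) ∈ S))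
          (fun t1 t2 x h1 h2 h3 h4 => comp_conv i _ h1 h2 h3 h4) (s := s) (b1 := b1) (b2 := b2)
          (fun h => hs h.1.self) hsv (lt_of_le_of_ne hs1 (by rintro rfl; exact hsv hb1))
          (lt_of_le_of_ne hs2 (by rintro rfl; exact hsv hb2)) hb1 hb2 K t hAlt
        exact hA v hv a t' ht')
      exact ⟨ω', hω', W', S', h1, Finer.trans' h2 hfin, h3⟩
end

def Main (α : Type u) [Crd M α] : Prop :=
  ∀ (ω : Type u) [Crd M ω] (W : Set ω) (S : Set (ω × α)), IsFam L (M := M) W S →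
    ∃ (ω' : Type u) (_ : Crd M ω') (W' : Set ω') (S' : Set (ω' × α)),
      IsFam L (M := M) W' S' ∧ Cpl L (M := M) W' S' ∧ Finer W' S' W S

theorem main_step (h : Main L (M := M) α) : Main L (M := M) (α × M) := by
  intro ω _ W S hF
  have := hF.hW
  have := hF.hS
  obtain ⟨δ, hδ, V, D, hD, hC, hfin⟩ := h ω W {p | ∃ t, (p.1, (p.2, t)) ∈ S} ⟨inferInstance, inferInstance,
    hF.nw, fun u hu => by
      obtain ⟨⟨a, t⟩, h⟩ := hF.ne u hu
      exact ⟨a, t, h⟩, fun u hu v hv => by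
      obtain ⟨w, hw, h⟩ := hF.dir u hu v hv
      refine ⟨w, hw, ?_⟩
      rintro a ⟨t, ht⟩
      exact ⟨⟨t, (h _ ht).1⟩, ⟨t, (h _ ht).2⟩⟩⟩
  have hOF : OF L V D W S := ⟨inferInstance, inferInstance, hF.nw, hfin, fun u hu v hv => by
    obtain ⟨w, hw, h⟩ := hF.dir u hu v hv
    exact ⟨w, hw, fun a t => h (a, t)⟩⟩
  obtain ⟨K, hK⟩ := alt_bound L (β := ω × α) {p | (p.1.1, (p.1.2, p.2)) ∈ S}
  obtain ⟨ω1, hω1, W1, S1, h1, h2, h3⟩ := M2 L hD hC K W S hOF (fun u _ a t => hK (u, a) t)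
  obtain ⟨ω2, hω2, W2, S2, h4, h5, h6⟩ := M3 L hD hC h1 h3
  exact ⟨ω2, hω2, W2, S2, h4, h5, Finer.trans' h6 h2⟩

theorem main_trans (h : Main L (M := M) α) (f : α → β) (g : β → α) (hf : DefF L M f) (hg : DefF L M g)
    (hfg : ∀ b, f (g b) = b) (hgf : ∀ a, g (f a) = a) : Main L (M := M) β := by
  have hpre : ∀ {α β ω : Type u} [Crd M α] [Crd M β] [Crd M ω] (f : α → β) (g : β → α) (hf : DefF L M f)
    (hfg : ∀ b, f (g b) = b) (W : Set ω) (S : Set (ω × β)), IsFam L (M := M) W S →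
      IsFam L (M := M) W {p | (p.1, f p.2) ∈ S} := by
    intro α β ω _ _ _ f g hf hfg W S hF
    refine ⟨hF.hW, ⟨?_⟩, hF.nw, ?_, ?_⟩
    · have hc : DefF L M (fun p : ω × α => f p.2) := hf.comp DefF.snd0
      exact hF.hS.out.comp (f := fun p : ω × α => (p.1, f p.2)) (DefF.pair (hf := inferInstance) (hg := hc))
    · intro u hu
      obtain ⟨b, hb⟩ := hF.ne u hu
      refine ⟨g b, ?_⟩
      change (u, f (g b)) ∈ S
      rwa [hfg]
    · intro u hu v hv
      obtain ⟨w, hw, h⟩ := hF.dir u hu v hv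
      exact ⟨w, hw, fun a ha => h _ ha⟩
  intro ω _ W S hF
  obtain ⟨δ, hδ, V, D, hD, hC, hfin⟩ := h ω W _ (hpre f g hf hfg W S hF)
  refine ⟨δ, hδ, V, _, hpre g f hg hgf V D hD, ?_, ?_⟩
  · intro X hX
    obtain ⟨u, hu, h1⟩ := hC {a | f a ∈ X} ⟨hX.out.comp hf⟩
    refine ⟨u, hu, h1.imp (fun h1 b hb => ?_) (fun h1 b hb => ?_)⟩
    · have := h1 _ hb
      change f (g b) ∈ X at this
      rwa [hfg] at this
    · have := h1 _ hb
      change f (g b) ∉ X at this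
      rwa [hfg] at this
  · intro u hu
    obtain ⟨d, hd, h1⟩ := hfin u hu
    refine ⟨d, hd, fun b hb => ?_⟩
    have := h1 _ hb
    change (u, f (g b)) ∈ S at this
    rwa [hfg] at this

theorem main_fin (n : ℕ) : Main L (M := M) (Fin n → M) := by
  induction n with
  | zero =>
    intro ω _ W S hF
    refine ⟨ω, inferInstance, W, S, hF, ?_, fun u hu => ⟨u, hu, fun _ h => h⟩⟩
    intro X hX
    obtain ⟨u, hu⟩ := hF.nw
    refine ⟨u, hu, ?_⟩
    by_cases h : (fun i => i.elim0 : Fin 0 → M) ∈ X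
    · left; intro a _; rwa [Subsingleton.elim a (fun i => i.elim0)]
    · right; intro a _; rwa [Subsingleton.elim a (fun i => i.elim0)]
  | succ n ih =>
    refine main_trans L (main_step L ih) (fun p => (Fin.snoc p.1 p.2 : Fin (n + 1) → M))
      (fun y => (Fin.init y, y (Fin.last n))) ?_ ?_ ?_ ?_
    · apply DefF.mkFin
      intro i
      refine Fin.lastCases ?_ (fun j => ?_) i
      · simp only [Fin.snoc_last]
        exact DefF.snd0
      · simp only [Fin.snoc_castSucc]
        exact DefF.coord (hf := DefF.fst0) j
    · have h1 : DefF L M (fun y : Fin (n + 1) → M => (Fin.init y : Fin n → M)) := by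
        apply DefF.mkFin
        intro i
        exact DefF.coord (hf := DefF.id') i.castSucc
      have h2 : DefF L M (fun y : Fin (n + 1) → M => y (Fin.last n)) :=
        DefF.coord (hf := DefF.id') (Fin.last n)
      exact DefF.pair (hf := h1) (hg := h2)
    · intro b
      exact Fin.snoc_init_self b
    · rintro ⟨a, t⟩
      simp

end
end OM

namespace OM
universe u v w
section
variable (L : FirstOrder.Language.{v, w}) {M : Type u} [L.Structure M]

theorem def_iff {n : ℕ} (X : Set (Fin n → M)) : (univ : Set M).Definable L X ↔ DefS L M X :=
  ⟨fun h => ⟨⟨h⟩⟩, fun h => h.out.out⟩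

theorem sum_def {m n : ℕ} (D : Set (Fin m ⊕ Fin n → M)) : (univ : Set M).Definable L D ↔
    DefS L M {p : (Fin m → M) × (Fin n → M) | Sum.elim p.1 p.2 ∈ D} := by
  have e : {x : Crd.ι M ((Fin m → M) × (Fin n → M)) → M | Crd.e.symm x ∈
      {p : (Fin m → M) × (Fin n → M) | Sum.elim p.1 p.2 ∈ D}} = D := by
    ext x
    change Sum.elim (fun i => x (Sum.inl i)) (fun i => x (Sum.inr i)) ∈ D ↔ x ∈ D
    have : Sum.elim (fun i => x (Sum.inl i)) (fun i => x (Sum.inr i)) = x := by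
      funext i; rcases i with i | i <;> rfl
    rw [this]
  constructor
  · intro h
    refine ⟨⟨?_⟩⟩
    exact e.symm ▸ h
  · intro h
    have := h.out.out
    exact e ▸ this

theorem fam_to {n : ℕ} (S : Set (Set (Fin n → M))) (hS : IsDefFamily L (Set.univ : Set M) n S)
    (hdir : DirectedFam S) (hne : S.Nonempty) :
    ∃ (ω : Type u) (_ : Crd M ω) (W : Set ω) (F : Set (ω × (Fin n → M))), IsFam L (M := M) W F ∧
      S = (fun u => {a | (u, a) ∈ F}) '' W := by
  obtain ⟨m, Ω, D, h1, h2, rfl⟩ := hS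
  refine ⟨Fin m → M, inferInstance, Ω, {p | Sum.elim p.1 p.2 ∈ D}, ⟨(def_iff L _).1 h1, (sum_def L _).1 h2, ?_, ?_, ?_⟩, rfl⟩
  · obtain ⟨_, u, hu, -⟩ := hne
    exact ⟨u, hu⟩
  · intro u hu
    by_contra hcon
    push Not at hcon
    exact hdir.1 ⟨u, hu, Set.eq_empty_iff_forall_notMem.2 hcon⟩
  · intro u hu v hv
    obtain ⟨Z, ⟨w, hw, rfl⟩, hZ⟩ := hdir.2 _ ⟨u, hu, rfl⟩ _ ⟨v, hv, rfl⟩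
    exact ⟨w, hw, fun a ha => hZ ha⟩

theorem fam_of {n : ℕ} (ω : Type u) [Crd M ω] (W : Set ω) (F : Set (ω × (Fin n → M)))
    (hF : IsFam L (M := M) W F) (k : ℕ) (f : (Fin k → M) → ω) (g : ω → (Fin k → M)) (hf : DefF L M f)
    (hfg : ∀ a, f (g a) = a) :
    IsDefFamily L (Set.univ : Set M) n ((fun u => {a | (u, a) ∈ F}) '' W) := by
  refine ⟨k, {x | f x ∈ W}, {y | (f (fun i => y (Sum.inl i)), fun i => y (Sum.inr i)) ∈ F}, ?_, ?_, ?_⟩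
  · exact (def_iff L _).2 ⟨hF.hW.out.comp hf⟩
  · rw [sum_def]
    have hc : DefF L M (fun p : (Fin k → M) × (Fin n → M) => f p.1) := hf.comp DefF.fst0
    exact ⟨hF.hS.out.comp (f := fun p : (Fin k → M) × (Fin n → M) => (f p.1, p.2))
      (DefF.pair (hf := hc) (hg := DefF.snd0))⟩
  · ext Z
    constructor
    · rintro ⟨u, hu, rfl⟩
      refine ⟨g u, ?_, ?_⟩
      · change f (g u) ∈ W
        rwa [hfg]
      · ext a
        change (f (g u), a) ∈ F ↔ (u, a) ∈ F
        rw [hfg]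
    · rintro ⟨x, hx, rfl⟩
      exact ⟨f x, hx, rfl⟩
end

section
variable (L : FirstOrder.Language.{v, w}) {M : Type u} [L.Structure M] [LinearOrder M] [OMin L M]
  [DenselyOrdered M] [NoMinOrder M] [NoMaxOrder M] [Nonempty M]

theorem final1 {n : ℕ} (S : Set (Set (Fin n → M))) (hS : IsDefFamily L (Set.univ : Set M) n S)
    (hdir : DirectedFam S) (hne : S.Nonempty) :
    ∃ C, IsDefFamily L (Set.univ : Set M) n C ∧ DirectedFam C ∧ IsCompleteFam L n C ∧ FinerThan C S := by
  obtain ⟨ω, _, W, F, hF, rfl⟩ := fam_to L S hS hdir hne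
  obtain ⟨ω', _, W', F', hF', hC, hfin⟩ := main_fin L (M := M) n ω W F hF
  obtain ⟨k, f, g, hf, hg, hfg⟩ := fin_crd L (M := M) ω'
  refine ⟨_, fam_of L ω' W' F' hF' k f g hf hfg, ⟨?_, ?_⟩, ?_, ?_⟩
  · rintro ⟨u, hu, h⟩
    obtain ⟨a, ha⟩ := hF'.ne u hu
    exact Set.eq_empty_iff_forall_notMem.1 h a ha
  · rintro _ ⟨u, hu, rfl⟩ _ ⟨v, hv, rfl⟩
    obtain ⟨w, hw, h⟩ := hF'.dir u hu v hv
    exact ⟨_, ⟨w, hw, rfl⟩, fun a ha => h a ha⟩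
  · intro X hX
    obtain ⟨u, hu, h⟩ := hC X ((def_iff L X).1 hX)
    refine ⟨_, ⟨u, hu, rfl⟩, h.imp (fun h a ha => h a ha) (fun h => ?_)⟩
    apply Set.eq_empty_iff_forall_notMem.2
    rintro a ⟨h1, h2⟩
    exact h a h1 h2
  · rintro _ ⟨u, hu, rfl⟩
    obtain ⟨v, hv, h⟩ := hfin u hu
    exact ⟨_, ⟨v, hv, rfl⟩, fun a ha => h a ha⟩

theorem final2 {n : ℕ} (S : Set (Set (Fin n → M))) (hS : IsDefFamily L (Set.univ : Set M) n S)
    (hdir : DirectedFam S) :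
    ∃ C, IsDefFamily L (Set.univ : Set M) n C ∧ DirectedFam C ∧ IsCompleteFam L n C ∧ FinerThan C S := by
  rcases S.eq_empty_or_nonempty with rfl | hne
  · obtain ⟨C, h1, h2, h3, -⟩ := final1 L (M := M) (n := n) {univ}
      ⟨0, univ, univ, definable_univ, definable_univ, by
        ext Z
        constructor
        · rintro rfl
          exact ⟨fun i => i.elim0, trivial, rfl⟩
        · rintro ⟨x, -, rfl⟩
          rfl⟩
      ⟨fun h => by
        obtain ⟨x⟩ := ‹Nonempty M›
        have h' : (∅ : Set (Fin n → M)) = univ := h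
        have : (fun _ => x : Fin n → M) ∈ (∅ : Set (Fin n → M)) := by rw [h']; trivial
        exact this, by
        rintro _ rfl _ rfl
        exact ⟨univ, rfl, fun _ _ => ⟨trivial, trivial⟩⟩⟩ ⟨univ, rfl⟩
    exact ⟨C, h1, h2, h3, fun X hX => absurd hX (Set.notMem_empty X)⟩
  · exact final1 L S hS hdir hne

theorem fiber_def {m n : ℕ} (D : Set (Fin m ⊕ Fin n → M)) (hD : (univ : Set M).Definable L D) (u : Fin m → M) :
    (univ : Set M).Definable L (famFiber D u) := by
  have := (sum_def L D).1 hD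
  rw [def_iff]
  exact ⟨this.out.comp (f := fun a : Fin n → M => (u, a)) inferInstance⟩

theorem final3 {n : ℕ} (S C : Set (Set (Fin n → M))) (hS : IsDefFamily L (Set.univ : Set M) n S)
    (hC : IsDefFamily L (Set.univ : Set M) n C) (hd : DirectedFam C) (hc : IsCompleteFam L n C)
    (hf : FinerThan C S) :
    ∃ p, IsTypeOn L n p ∧ IsDefTypeOver L (Set.univ : Set M) n p ∧ S ⊆ p ∧
      HasDefBasis L (Set.univ : Set M) n p := by
  have hmem : ∀ {S : Set (Set (Fin n → M))}, IsDefFamily L (Set.univ : Set M) n S → ∀ X ∈ S,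
      (univ : Set M).Definable L X := by
    rintro S ⟨m, Ω, D, h1, h2, rfl⟩ _ ⟨u, hu, rfl⟩
    exact fiber_def L D h2 u
  refine ⟨{X | (univ : Set M).Definable L X ∧ ∃ Z ∈ C, Z ⊆ X}, ⟨fun X hX => hX.1, ?_, ?_, ?_, ?_⟩, ?_, ?_, ?_⟩
  · rintro ⟨-, Z, hZ, h⟩
    rw [Set.subset_empty_iff] at h
    exact hd.1 (h ▸ hZ)
  · rintro X ⟨h1, Z, hZ, h2⟩ Y ⟨h3, Z', hZ', h4⟩
    obtain ⟨Z'', h5, h6⟩ := hd.2 Z hZ Z' hZ'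
    exact ⟨h1.inter h3, Z'', h5, h6.trans (Set.inter_subset_inter h2 h4)⟩
  · rintro X ⟨h1, Z, hZ, h2⟩ Y h3 h4
    exact ⟨h3, Z, hZ, h2.trans h4⟩
  · intro X hX
    obtain ⟨Z, hZ, h | h⟩ := hc X hX
    · exact Or.inl ⟨hX, Z, hZ, h⟩
    · refine Or.inr ⟨hX.compl, Z, hZ, fun a ha hx => ?_⟩
      exact Set.eq_empty_iff_forall_notMem.1 h a ⟨ha, hx⟩
  · intro m D hD
    have hD' : (univ : Set M).Definable L D := hD.mono (Set.empty_subset _)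
    obtain ⟨k, Ω, E, h1, h2, rfl⟩ := hC
    have i1 := (def_iff L _).1 h1
    have i2 := (sum_def L _).1 h2
    have i3 := (sum_def L _).1 hD'
    obtain ⟨E', hE'⟩ : ∃ E', E' = {p : (Fin k → M) × (Fin n → M) | Sum.elim p.1 p.2 ∈ E} := ⟨_, rfl⟩
    obtain ⟨D', hDD⟩ : ∃ D', D' = {p : (Fin m → M) × (Fin n → M) | Sum.elim p.1 p.2 ∈ D} := ⟨_, rfl⟩
    rw [← hE'] at i2
    rw [← hDD] at i3
    rw [def_iff]
    have key : DefP L M (fun u : Fin m → M => ∃ w, w ∈ Ω ∧ ∀ v, (w, v) ∈ E' → (u, v) ∈ D') := inferInstance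
    refine ⟨key.congr fun u => ?_⟩
    rw [hE', hDD]
    constructor
    · rintro ⟨-, _, ⟨w, hw, rfl⟩, h⟩
      exact ⟨w, hw, fun v hv => h hv⟩
    · rintro ⟨w, hw, h⟩
      exact ⟨fiber_def L D hD' u, _, ⟨w, hw, rfl⟩, fun v hv => h v hv⟩
  · intro X hX
    exact ⟨hmem hS X hX, hf X hX⟩
  · refine ⟨C, hC, fun X hX => ⟨hmem hC X hX, X, hX, subset_rfl⟩, hd, ?_⟩
    rintro Y ⟨-, Z, hZ, h⟩
    exact ⟨Z, hZ, h⟩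
end
end OM

/-- Lemma on complete families: every definable downward directed family admits a
finer complete definable downward directed family; in particular it extends to a definable type
with a definable basis. -/
theorem statement2 (L : FirstOrder.Language) (M : Type*) [L.Structure M] [LinearOrder M]
    (hM : IsOMinimal L M) (n : ℕ) (S : Set (Set (Fin n → M)))
    (hS : IsDefFamily L (Set.univ : Set M) n S) (hdir : DirectedFam S) :
    (∃ C, IsDefFamily L (Set.univ : Set M) n C ∧ DirectedFam C ∧ IsCompleteFam L n C ∧
      FinerThan C S) ∧
    (∃ p, IsTypeOn L n p ∧ IsDefTypeOver L (Set.univ : Set M) n p ∧ S ⊆ p ∧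
      HasDefBasis L (Set.univ : Set M) n p) := by
  obtain ⟨h1, h2, h3, h4, h5, h6⟩ := hM
  have : OM.OMin L M := ⟨h5.mono (Set.empty_subset _), h6⟩
  obtain ⟨C, hC1, hC2, hC3, hC4⟩ := OM.final2 L S hS hdir
  exact ⟨⟨C, hC1, hC2, hC3, hC4⟩, OM.final3 L S C hS hC1 hC2 hC3 hC4⟩
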